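/- arXiv:2312.15333 — 2 statements merged into one kernel-verified Lean document; each statement's English description precedes it below -/
import Mathlib

section
/- Let c = 2^{-8}. Let x, y > 0 with x ≤ y ≤ c, and let G be a c·y³-sparse graph with no copy of the complement of P5 and with |G| ≥ y^{-6}. Then either: (1) there exists S ⊆ V(G) with |S| ≥ c·|G| such that G[S] is 2y⁴-sparse; or (2) there exist a real k with y^{-1/4} ≤ k ≤ 1/x and a pure (k, |G|/k^{30})-blockade in G; or (3) there is an x-sparse (y^{-1}, y⁶·|G|)-blockade in G. -/
open Finset
open scoped Classical

/-- A copy of `H` in `G`: an injective map preserving adjacency and non-adjacency. -/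
def IsCopy {W V : Type*} (H : SimpleGraph W) (G : SimpleGraph V) (f : W → V) : Prop :=
  Function.Injective f ∧ ∀ u v : W, H.Adj u v ↔ G.Adj (f u) (f v)

/-- `G` is `H`-free: there is no copy of `H` in `G`. -/
def Free {W V : Type*} (H : SimpleGraph W) (G : SimpleGraph V) : Prop :=
  ¬ ∃ f : W → V, IsCopy H G f

/-- The path on five vertices. -/
def P5 : SimpleGraph (Fin 5) := SimpleGraph.pathGraph 5

/-- The neighbours of `v` inside the finite set `A`. -/
noncomputable def nbrsIn {V : Type*} (G : SimpleGraph V) (v : V) (A : Finset V) : Finset V :=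
  A.filter (fun u => G.Adj v u)

/-- `G` is `x`-sparse: every vertex has degree at most `x * |G|`. -/
def Sparse {V : Type*} [Fintype V] (G : SimpleGraph V) (x : ℝ) : Prop :=
  ∀ v : V, ((nbrsIn G v Finset.univ).card : ℝ) ≤ x * (Fintype.card V : ℝ)

/-- `G` is `x`-restricted: `G` or its complement is `x`-sparse. -/
def Restricted {V : Type*} [Fintype V] (G : SimpleGraph V) (x : ℝ) : Prop :=
  Sparse G x ∨ Sparse Gᶜ x

/-- The induced subgraph `G[S]` is `x`-sparse. -/
def SparseOn {V : Type*} (G : SimpleGraph V) (S : Finset V) (x : ℝ) : Prop :=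
  ∀ v ∈ S, ((nbrsIn G v S).card : ℝ) ≤ x * (S.card : ℝ)

/-- The induced subgraph `G[S]` is `x`-restricted: it or its complement is `x`-sparse. -/
def RestrictedOn {V : Type*} (G : SimpleGraph V) (S : Finset V) (x : ℝ) : Prop :=
  SparseOn G S x ∨ SparseOn Gᶜ S x

/-- `(A, B)` is complete in `G`. -/
def CompletePair {V : Type*} (G : SimpleGraph V) (A B : Finset V) : Prop :=
  ∀ a ∈ A, ∀ b ∈ B, G.Adj a b

/-- `(A, B)` is anticomplete in `G`. -/
def AnticompletePair {V : Type*} (G : SimpleGraph V) (A B : Finset V) : Prop :=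
  ∀ a ∈ A, ∀ b ∈ B, ¬ G.Adj a b

/-- `B` is `x`-sparse to `A` in `G`: every vertex of `B` has at most `x * |A|` neighbours in `A`. -/
def SparseTo {V : Type*} (G : SimpleGraph V) (x : ℝ) (A B : Finset V) : Prop :=
  ∀ v ∈ B, ((nbrsIn G v A).card : ℝ) ≤ x * (A.card : ℝ)

/-- The number of edges of `G` between `A` and `B`. -/
noncomputable def edgesBetween {V : Type*} (G : SimpleGraph V) (A B : Finset V) : ℕ :=
  ((A ×ˢ B).filter (fun p => G.Adj p.1 p.2)).card

/-- `(A, B)` is weakly `x`-sparse in `G`. -/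
def WeaklySparse {V : Type*} (G : SimpleGraph V) (x : ℝ) (A B : Finset V) : Prop :=
  (edgesBetween G A B : ℝ) ≤ x * (A.card : ℝ) * (B.card : ℝ)

/-- A blockade: a sequence of pairwise disjoint vertex subsets. -/
def IsBlockade {V : Type*} {n : ℕ} (B : Fin n → Finset V) : Prop :=
  ∀ i j : Fin n, i ≠ j → Disjoint (B i) (B j)

/-- A pure blockade: every pair of distinct blocks is complete or anticomplete. -/
def PureBlockade {V : Type*} (G : SimpleGraph V) {n : ℕ} (B : Fin n → Finset V) : Prop :=
  ∀ i j : Fin n, i ≠ j → CompletePair G (B i) (B j) ∨ AnticompletePair G (B i) (B j)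

/-- A complete blockade. -/
def CompleteBlockade {V : Type*} (G : SimpleGraph V) {n : ℕ} (B : Fin n → Finset V) : Prop :=
  ∀ i j : Fin n, i ≠ j → CompletePair G (B i) (B j)

/-- An anticomplete blockade. -/
def AnticompleteBlockade {V : Type*} (G : SimpleGraph V) {n : ℕ} (B : Fin n → Finset V) : Prop :=
  ∀ i j : Fin n, i ≠ j → AnticompletePair G (B i) (B j)

/-- An `x`-sparse blockade: `B j` is `x`-sparse to `B i` whenever `i < j`. -/
def SparseBlockade {V : Type*} (G : SimpleGraph V) (x : ℝ) {n : ℕ} (B : Fin n → Finset V) : Prop :=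
  ∀ i j : Fin n, i < j → SparseTo G x (B i) (B j)

/-- A comb: a blockade `Bl` together with distinct apexes `a i`, outside all blocks, such that
`a i` is adjacent to all of `Bl i` and nonadjacent to all of `Bl j` for `j ≠ i`. -/
def IsComb {V : Type*} (G : SimpleGraph V) {k : ℕ} (a : Fin k → V) (Bl : Fin k → Finset V) :
    Prop :=
  IsBlockade Bl ∧ Function.Injective a ∧ (∀ i j : Fin k, a i ∉ Bl j) ∧
  (∀ i : Fin k, ∀ v ∈ Bl i, G.Adj (a i) v) ∧
  (∀ i j : Fin k, i ≠ j → ∀ v ∈ Bl j, ¬ G.Adj (a i) v)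

/-- `(A, B)` is complete or anticomplete in `G`. -/
def PurePair {V : Type*} (G : SimpleGraph V) (A B : Finset V) : Prop :=
  CompletePair G A B ∨ AnticompletePair G A B

/-- `K` is nonempty, and both `G[K]` and its complement are connected. -/
def Indecomposable {V : Type*} (G : SimpleGraph V) (K : Finset V) : Prop :=
  K.Nonempty ∧ ∀ X ⊆ K, PurePair G X (K \ X) → X = ∅ ∨ X = K

/-- `K` is a module (homogeneous set) of `G[A]`. -/
def IsModule {V : Type*} (G : SimpleGraph V) (A K : Finset V) : Prop :=
  K ⊆ A ∧ ∀ p ∈ A, p ∉ K → (∀ u ∈ K, G.Adj p u) ∨ (∀ u ∈ K, ¬ G.Adj p u)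

/-- A family of pairwise disjoint and pairwise pure sets. -/
def PureFamily {V : Type*} (G : SimpleGraph V) (F : Finset (Finset V)) : Prop :=
  ∀ X ∈ F, ∀ Y ∈ F, X ≠ Y → Disjoint X Y ∧ PurePair G X Y

section Modules

variable {V : Type*} {G : SimpleGraph V}

lemma PurePair.symm {A B : Finset V} (h : PurePair G A B) : PurePair G B A := by
  rcases h with h | h
  · exact Or.inl fun b hb a ha => (h a ha b hb).symm
  · exact Or.inr fun b hb a ha hab => h a ha b hb hab.symm

lemma PurePair.mono {A B A' B' : Finset V} (h : PurePair G A B) (hA : A' ⊆ A) (hB : B' ⊆ B) :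
    PurePair G A' B' := by
  rcases h with h | h
  · exact Or.inl fun a ha b hb => h a (hA ha) b (hB hb)
  · exact Or.inr fun a ha b hb => h a (hA ha) b (hB hb)

lemma IsModule.trans {S T K : Finset V} (hT : IsModule G S T) (hK : IsModule G T K) :
    IsModule G S K := by
  refine ⟨hK.1.trans hT.1, fun p hp hpK => ?_⟩
  by_cases hpT : p ∈ T
  · exact hK.2 p hpT hpK
  · exact (hT.2 p hp hpT).imp (fun h u hu => h u (hK.1 hu)) (fun h u hu => h u (hK.1 hu))

lemma isModule_of_purePair {T X : Finset V} (hX : X ⊆ T) (h : PurePair G X (T \ X)) :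
    IsModule G T X := by
  refine ⟨hX, fun p hp hpX => ?_⟩
  have hp' : p ∈ T \ X := mem_sdiff.2 ⟨hp, hpX⟩
  rcases h with h | h
  · exact Or.inl fun u hu => (h u hu p hp').symm
  · exact Or.inr fun u hu hpu => h u hu p hp' hpu.symm

/-- An indecomposable module does not overlap any module. -/
lemma Indecomposable.nested {A K L : Finset V} (hK : Indecomposable G K) (hKA : IsModule G A K)
    (hLA : IsModule G A L) (h : (K ∩ L).Nonempty) : K ⊆ L ∨ L ⊆ K := by
  by_contra! hcon
  obtain ⟨hKL, hLK⟩ := hcon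
  obtain ⟨c, hcL, hcK⟩ := not_subset.1 hLK
  obtain ⟨b, hbK, hbL⟩ := not_subset.1 hKL
  obtain ⟨e, he⟩ := h
  rw [mem_inter] at he
  have hpure : PurePair G (K \ L) (K \ (K \ L)) := by
    rcases hKA.2 c (hLA.1 hcL) hcK with hc | hc
    · left
      intro u hu w hw
      simp only [mem_sdiff, not_and, not_not] at hu hw
      rcases hLA.2 u (hKA.1 hu.1) hu.2 with h1 | h1
      · exact h1 w (hw.2 hw.1)
      · exact absurd (hc u hu.1).symm (h1 c hcL)
    · right
      intro u hu w hw
      simp only [mem_sdiff, not_and, not_not] at hu hw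
      rcases hLA.2 u (hKA.1 hu.1) hu.2 with h1 | h1
      · exact absurd (h1 c hcL).symm (hc u hu.1)
      · exact h1 w (hw.2 hw.1)
  rcases hK.2 _ sdiff_subset hpure with h0 | h0
  · exact (notMem_empty b) (h0 ▸ mem_sdiff.2 ⟨hbK, hbL⟩)
  · exact (mem_sdiff.1 (h0.symm ▸ he.1 : e ∈ K \ L)).2 he.2

lemma purePair_of_disjoint_modules {A K L : Finset V} (hKA : IsModule G A K)
    (hLA : IsModule G A L) (hd : Disjoint K L) : PurePair G K L := by
  by_cases hL : L.Nonempty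
  · obtain ⟨c, hc⟩ := hL
    have key : ∀ u ∈ K, (∀ w ∈ L, G.Adj u w) ∨ (∀ w ∈ L, ¬ G.Adj u w) := fun u hu =>
      hLA.2 u (hKA.1 hu) (disjoint_left.1 hd hu)
    rcases hKA.2 c (hLA.1 hc) (disjoint_right.1 hd hc) with h | h
    · left
      intro u hu
      rcases key u hu with h1 | h1
      · exact h1
      · exact absurd (h u hu).symm (h1 c hc)
    · right
      intro u hu
      rcases key u hu with h1 | h1
      · exact absurd (h1 c hc).symm (h u hu)
      · exact h1
  · rw [not_nonempty_iff_eq_empty] at hL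
    subst hL
    left
    intro a _ b hb
    simp at hb

lemma Indecomposable.subset_of_purePair {X Y K : Finset V} (hK : Indecomposable G K)
    (h : PurePair G X Y) (hKXY : K ⊆ X ∪ Y) : K ⊆ X ∨ K ⊆ Y := by
  have h1 : K \ (K ∩ X) ⊆ Y := by
    intro u hu
    simp only [mem_sdiff, mem_inter, not_and] at hu
    exact (mem_union.1 (hKXY hu.1)).resolve_left (hu.2 hu.1)
  rcases hK.2 (K ∩ X) inter_subset_left (h.mono inter_subset_right h1) with h0 | h0
  · right
    simpa [h0] using h1
  · left
    exact inter_eq_left.1 h0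

/-- If no indecomposable module of `G[S]` has more than half of the weight, then `S` includes
a pure pair of sets having at least a quarter of the weight each. -/
lemma exists_heavy_purePair {S D : Finset V} (hpos : 0 < (S ∩ D).card)
    (h : ∀ K, Indecomposable G K → IsModule G S K → 2 * (K ∩ D).card ≤ (S ∩ D).card) :
    ∃ X Y : Finset V, X ⊆ S ∧ Y ⊆ S ∧ Disjoint X Y ∧ PurePair G X Y ∧
      (S ∩ D).card ≤ 4 * (X ∩ D).card ∧ (S ∩ D).card ≤ 4 * (Y ∩ D).card ∧
      (∀ K, Indecomposable G K → IsModule G X K → IsModule G S K) ∧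
      (∀ K, Indecomposable G K → IsModule G Y K → IsModule G S K) := by
  set W := (S ∩ D).card with hW
  let good : Finset V → Prop := fun T => ∃ P Q : Finset V, P ∪ Q ∪ T = S ∧ Disjoint P T ∧
    Disjoint Q T ∧ CompletePair G T P ∧ AnticompletePair G T Q ∧
    4 * (P ∩ D).card < W ∧ 4 * (Q ∩ D).card < W ∧
    (∀ K, Indecomposable G K → IsModule G P K → IsModule G S K) ∧
    (∀ K, Indecomposable G K → IsModule G Q K → IsModule G S K)
  have hempty : ∀ K, Indecomposable G K → IsModule G ∅ K → IsModule G S K := fun K hK hK' =>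
    absurd (subset_empty.1 hK'.1) hK.1.ne_empty
  have hex : ∃ n, ∃ T, good T ∧ T.card = n :=
    ⟨_, S, ⟨∅, ∅, by simp, by simp, by simp, by simp [CompletePair], by simp [AnticompletePair],
      by simpa using hpos, by simpa using hpos, hempty, hempty⟩, rfl⟩
  obtain ⟨T, ⟨P, Q, hS, hPT, hQT, hP, hQ, hPw, hQw, hPm, hQm⟩, hTn⟩ := Nat.find_spec hex
  have hmin : ∀ T', good T' → T.card ≤ T'.card := fun T' hT' => by
    rw [hTn]
    exact Nat.find_min' hex ⟨T', hT', rfl⟩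
  have hTw : W < 2 * (T ∩ D).card := by
    have h1 : (S ∩ D).card ≤ (P ∩ D).card + (Q ∩ D).card + (T ∩ D).card := by
      rw [← hS, union_inter_distrib_right, union_inter_distrib_right]
      exact (card_union_le _ _).trans (Nat.add_le_add_right (card_union_le _ _) _)
    omega
  have hTS : IsModule G S T := by
    refine ⟨hS ▸ subset_union_right, fun p hp hpT => ?_⟩
    rw [← hS, mem_union, mem_union] at hp
    rcases hp with (hp | hp) | hp
    · exact Or.inl fun u hu => (hP u hu p hp).symm
    · exact Or.inr fun u hu hpu => hQ u hu p hp hpu.symm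
    · exact absurd hp hpT
  have hTne : T.Nonempty := by
    rw [nonempty_iff_ne_empty]
    rintro rfl
    simp at hTw
  have hnot : ¬ Indecomposable G T := fun hT => by
    have := h T hT hTS
    omega
  have hsplit : ∃ X ⊆ T, PurePair G X (T \ X) ∧ X ≠ ∅ ∧ X ≠ T := by
    by_contra! hcon
    exact hnot ⟨hTne, fun X hX hp => or_iff_not_imp_left.2 fun h0 =>
      hcon X hX hp (nonempty_iff_ne_empty.2 h0)⟩
  have hheavy : ∃ X Y : Finset V, X ∪ Y = T ∧ Disjoint X Y ∧ PurePair G X Y ∧ Y.Nonempty ∧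
      W ≤ 4 * (X ∩ D).card := by
    obtain ⟨X, hX, hp, h0, h1⟩ := hsplit
    have hw : (T ∩ D).card ≤ (X ∩ D).card + ((T \ X) ∩ D).card := by
      conv_lhs => rw [← union_sdiff_of_subset hX, union_inter_distrib_right]
      exact card_union_le _ _
    by_cases hc : W ≤ 4 * (X ∩ D).card
    · refine ⟨X, T \ X, union_sdiff_of_subset hX, disjoint_sdiff, hp, ?_, hc⟩
      rw [sdiff_nonempty]
      exact fun hTX => h1 (Subset.antisymm hX hTX)
    · exact ⟨T \ X, X, sdiff_union_of_subset hX, sdiff_disjoint, hp.symm,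
        nonempty_iff_ne_empty.2 h0, by omega⟩
  obtain ⟨X, Y, hXY, hdXY, hpXY, hYne, hXw⟩ := hheavy
  have hXT : X ⊆ T := hXY ▸ subset_union_left
  have hYT : Y ⊆ T := hXY ▸ subset_union_right
  have hXm : IsModule G T X := isModule_of_purePair hXT (hpXY.mono (Subset.refl _) (by
    intro u hu
    rw [← hXY] at hu
    simp only [mem_sdiff, mem_union] at hu
    tauto))
  have hYm : IsModule G T Y := isModule_of_purePair hYT (hpXY.symm.mono (Subset.refl _) (by
    intro u hu
    rw [← hXY] at hu
    simp only [mem_sdiff, mem_union] at hu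
    tauto))
  have hcard : X.card < T.card := by
    rw [← hXY, card_union_of_disjoint hdXY]
    have := hYne.card_pos
    omega
  have hXS : ∀ K, Indecomposable G K → IsModule G X K → IsModule G S K := fun K _ hK =>
    hTS.trans (hXm.trans hK)
  have hmerge : ∀ P' : Finset V, PurePair G T P' →
      (∀ K, Indecomposable G K → IsModule G P' K → IsModule G S K) →
      ∀ K, Indecomposable G K → IsModule G (P' ∪ Y) K → IsModule G S K := by
    intro P' hpure hP' K hK hKm
    rcases hK.subset_of_purePair (hpure.symm.mono (Subset.refl _) hYT) hKm.1 with hs | hs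
    · exact hP' K hK ⟨hs, fun p hp => hKm.2 p (mem_union_left _ hp)⟩
    · exact hTS.trans (hYm.trans ⟨hs, fun p hp => hKm.2 p (mem_union_right _ hp)⟩)
  have hPS : P ⊆ S := hS ▸ subset_union_left.trans subset_union_left
  have hQS : Q ⊆ S := hS ▸ subset_union_right.trans subset_union_left
  rcases hpXY with hc | hc
  · have hcomp : CompletePair G X (P ∪ Y) := fun a ha b hb =>
      (mem_union.1 hb).elim (fun hb => hP a (hXT ha) b hb) (fun hb => hc a ha b hb)
    have hdis : Disjoint (P ∪ Y) X :=
      disjoint_union_left.2 ⟨hPT.mono_right hXT, hdXY.symm⟩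
    by_cases hbig : W ≤ 4 * ((P ∪ Y) ∩ D).card
    · exact ⟨X, P ∪ Y, hXT.trans hTS.1, union_subset hPS (hYT.trans hTS.1), hdis.symm,
        Or.inl hcomp, hXw, hbig, hXS, hmerge P (Or.inl hP) hPm⟩
    · have := hmin X ⟨P ∪ Y, Q, by rw [← hS, ← hXY]; ext; simp only [mem_union]; tauto, hdis,
        hQT.mono_right hXT, hcomp, fun a ha => hQ a (hXT ha), by omega, hQw,
        hmerge P (Or.inl hP) hPm, hQm⟩
      omega
  · have hanti : AnticompletePair G X (Q ∪ Y) := fun a ha b hb =>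
      (mem_union.1 hb).elim (fun hb => hQ a (hXT ha) b hb) (fun hb => hc a ha b hb)
    have hdis : Disjoint (Q ∪ Y) X :=
      disjoint_union_left.2 ⟨hQT.mono_right hXT, hdXY.symm⟩
    by_cases hbig : W ≤ 4 * ((Q ∪ Y) ∩ D).card
    · exact ⟨X, Q ∪ Y, hXT.trans hTS.1, union_subset hQS (hYT.trans hTS.1), hdis.symm,
        Or.inr hanti, hXw, hbig, hXS, hmerge Q (Or.inr hQ) hQm⟩
    · have := hmin X ⟨P, Q ∪ Y, by rw [← hS, ← hXY]; ext; simp only [mem_union]; tauto,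
        hPT.mono_right hXT, hdis, fun a ha => hP a (hXT ha), hanti, hPw, by omega, hPm,
        hmerge Q (Or.inr hQ) hQm⟩
      omega

/-- If every indecomposable module of `G[S]` has weight less than `m`, and `S` has weight at least
`4 ^ d * m`, then `S` includes `2 ^ d` disjoint, pairwise pure sets of weight at least `m`. -/
lemma exists_pureFamily_of_light_modules {D : Finset V} {m : ℝ} (hm : 0 < m) (d : ℕ) :
    ∀ S : Finset V, (∀ K, Indecomposable G K → IsModule G S K → ((K ∩ D).card : ℝ) < m) →
      4 ^ d * m ≤ ((S ∩ D).card : ℝ) →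
      ∃ F : Finset (Finset V), PureFamily G F ∧ 2 ^ d ≤ F.card ∧
        ∀ X ∈ F, X ⊆ S ∧ m ≤ ((X ∩ D).card : ℝ) := by
  induction d with
  | zero =>
    intro S _ hS
    refine ⟨{S}, ?_, by simp, by simpa using hS⟩
    intro X hX Y hY hne
    rw [mem_singleton] at hX hY
    exact absurd (hX.trans hY.symm) hne
  | succ d ih =>
    intro S hK hS
    have h4 : (1 : ℝ) ≤ 4 ^ d := one_le_pow₀ (by norm_num)
    rw [pow_succ] at hS
    have hmS : 4 * m ≤ ((S ∩ D).card : ℝ) := by nlinarith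
    obtain ⟨X, Y, hXS, hYS, hd, hp, hXw, hYw, hXm, hYm⟩ :=
      exists_heavy_purePair (G := G) (S := S) (D := D)
        (by
          have : (0 : ℝ) < ((S ∩ D).card : ℝ) := by linarith
          exact_mod_cast this)
        (fun K hK1 hK2 => by
          have := hK K hK1 hK2
          have : 2 * ((K ∩ D).card : ℝ) ≤ ((S ∩ D).card : ℝ) := by linarith
          exact_mod_cast this)
    have hXw' : ((S ∩ D).card : ℝ) ≤ 4 * ((X ∩ D).card : ℝ) := by exact_mod_cast hXw
    have hYw' : ((S ∩ D).card : ℝ) ≤ 4 * ((Y ∩ D).card : ℝ) := by exact_mod_cast hYw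
    obtain ⟨F₁, hF₁, hc₁, hs₁⟩ := ih X (fun K h1 h2 => hK K h1 (hXm K h1 h2)) (by linarith)
    obtain ⟨F₂, hF₂, hc₂, hs₂⟩ := ih Y (fun K h1 h2 => hK K h1 (hYm K h1 h2)) (by linarith)
    have hcross : ∀ P ∈ F₁, ∀ Q ∈ F₂, Disjoint P Q ∧ PurePair G P Q := fun P hP Q hQ =>
      ⟨hd.mono (hs₁ P hP).1 (hs₂ Q hQ).1, hp.mono (hs₁ P hP).1 (hs₂ Q hQ).1⟩
    refine ⟨F₁ ∪ F₂, ?_, ?_, ?_⟩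
    · intro P hP Q hQ hne
      rw [mem_union] at hP hQ
      rcases hP with hP | hP <;> rcases hQ with hQ | hQ
      · exact hF₁ P hP Q hQ hne
      · exact hcross P hP Q hQ
      · exact ⟨(hcross Q hQ P hP).1.symm, (hcross Q hQ P hP).2.symm⟩
      · exact hF₂ P hP Q hQ hne
    · rw [card_union_of_disjoint, pow_succ]
      · omega
      · rw [disjoint_left]
        intro P hP hP'
        have h0 : P = ∅ := disjoint_self.1 (hcross P hP P hP').1
        have := (hs₁ P hP).2
        rw [h0] at this
        simp at this
        linarith
    · intro P hP
      rcases mem_union.1 hP with hP | hP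
      · exact ⟨(hs₁ P hP).1.trans hXS, (hs₁ P hP).2⟩
      · exact ⟨(hs₂ P hP).1.trans hYS, (hs₂ P hP).2⟩

/-- The indecomposable modules of size at least `t` can be hit by few vertices. -/
lemma exists_hitting_set (G : SimpleGraph V) (A : Finset V) (t : ℝ) :
    ∃ R ⊆ A, (R.card : ℝ) * t ≤ A.card ∧
      ∀ K, Indecomposable G K → IsModule G A K → t ≤ K.card → ∃ r ∈ R, r ∈ K := by
  let big : Finset V → Prop := fun K => Indecomposable G K ∧ IsModule G A K ∧ t ≤ K.card
  let M := A.powerset.filter fun K => big K ∧ ∀ L, big L → L ⊆ K → L = K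
  have hM : ∀ K ∈ M, big K ∧ ∀ L, big L → L ⊆ K → L = K := fun K hK => (mem_filter.1 hK).2
  have hsub : ∀ K, big K → ∃ L ∈ M, L ⊆ K := by
    intro K
    induction K using Finset.strongInduction with
    | H K ih =>
      intro hK
      by_cases h : ∀ L, big L → L ⊆ K → L = K
      · exact ⟨K, mem_filter.2 ⟨mem_powerset.2 hK.2.1.1, hK, h⟩, Subset.refl _⟩
      · push Not at h
        obtain ⟨L, hL, hLK, hne⟩ := h
        obtain ⟨L', hL', h'⟩ := ih L (hLK.ssubset_of_ne hne) hL
        exact ⟨L', hL', h'.trans hLK⟩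
  have hdisj : ∀ K ∈ M, ∀ L ∈ M, K ≠ L → Disjoint K L := by
    intro K hK L hL hne
    by_contra hd
    rw [not_disjoint_iff_nonempty_inter] at hd
    rcases (hM K hK).1.1.nested (hM K hK).1.2.1 (hM L hL).1.2.1 hd with h | h
    · exact hne ((hM L hL).2 K (hM K hK).1 h)
    · exact hne ((hM K hK).2 L (hM L hL).1 h).symm
  rcases isEmpty_or_nonempty V with hV | hV
  · exact ⟨∅, by simp, by simp, fun K hK => hV.elim hK.1.choose⟩
  choose! f hf using fun K (hK : K ∈ M) => (hM K hK).1.1.1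
  refine ⟨M.image f, ?_, ?_, ?_⟩
  · intro r hr
    obtain ⟨K, hK, rfl⟩ := mem_image.1 hr
    exact (hM K hK).1.2.1.1 (hf K hK)
  · have h1 : (M.biUnion id).card = ∑ K ∈ M, K.card := card_biUnion hdisj
    have h2 : (M.biUnion id).card ≤ A.card := card_le_card (biUnion_subset.2 fun K hK =>
      (hM K hK).1.2.1.1)
    have h3 : (M.card : ℝ) * t ≤ ∑ K ∈ M, (K.card : ℝ) := by
      rw [← nsmul_eq_mul]
      exact card_nsmul_le_sum _ _ _ fun K hK => (hM K hK).1.2.2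
    have h4 : ∑ K ∈ M, (K.card : ℝ) ≤ A.card := by
      rw [← Nat.cast_sum, ← h1]
      exact_mod_cast h2
    have h5 : (M.image f).card = M.card := card_image_of_injOn (by
      intro K hK L hL hKL
      by_contra hne
      exact disjoint_left.1 (hdisj K hK L hL hne) (hf K hK)
        (by rw [hKL]; exact hf L hL))
    rw [h5]
    exact h3.trans h4
  · intro K h1 h2 h3
    obtain ⟨L, hL, hLK⟩ := hsub K ⟨h1, h2, h3⟩
    exact ⟨f L, mem_image_of_mem f hL, hLK (hf L hL)⟩

/-- The maximal indecomposable modules avoiding `R` form a pure family. -/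
lemma exists_pureFamily_avoiding (G : SimpleGraph V) (A R : Finset V) :
    ∃ F : Finset (Finset V), PureFamily G F ∧
      (∀ K ∈ F, Indecomposable G K ∧ IsModule G A K ∧ Disjoint K R) ∧
      ∀ K, Indecomposable G K → IsModule G A K → Disjoint K R → ∃ L ∈ F, K ⊆ L := by
  let ok : Finset V → Prop := fun K => Indecomposable G K ∧ IsModule G A K ∧ Disjoint K R
  let F := A.powerset.filter fun K => ok K ∧ ∀ L, ok L → K ⊆ L → L = K
  have hF : ∀ K ∈ F, ok K ∧ ∀ L, ok L → K ⊆ L → L = K := fun K hK => (mem_filter.1 hK).2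
  refine ⟨F, ?_, fun K hK => (hF K hK).1, ?_⟩
  · intro K hK L hL hne
    have hd : Disjoint K L := by
      by_contra hd
      rw [not_disjoint_iff_nonempty_inter] at hd
      rcases (hF K hK).1.1.nested (hF K hK).1.2.1 (hF L hL).1.2.1 hd with h | h
      · exact hne ((hF K hK).2 L (hF L hL).1 h).symm
      · exact hne ((hF L hL).2 K (hF K hK).1 h)
    exact ⟨hd, purePair_of_disjoint_modules (hF K hK).1.2.1 (hF L hL).1.2.1 hd⟩
  · have key : ∀ n : ℕ, ∀ K, ok K → A.card - K.card = n → ∃ L ∈ F, K ⊆ L := by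
      intro n
      induction n using Nat.strong_induction_on with
      | _ n ih =>
        intro K hK hn
        by_cases h : ∀ L, ok L → K ⊆ L → L = K
        · exact ⟨K, mem_filter.2 ⟨mem_powerset.2 hK.2.1.1, hK, h⟩, Subset.refl _⟩
        · push Not at h
          obtain ⟨L, hL, hKL, hne⟩ := h
          have h1 := card_lt_card (hKL.ssubset_of_ne hne.symm)
          have h2 := card_le_card hL.2.1.1
          obtain ⟨L', hL', h'⟩ := ih (A.card - L.card) (by omega) L hL rfl
          exact ⟨L', hL', hKL.trans h'⟩
    exact fun K h1 h2 h3 => key _ K ⟨h1, h2, h3⟩ rfl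

/-- In a house-free graph, an indecomposable module of the common neighbourhood of two nonadjacent
vertices in `A` is a module of `G[A]`, provided one of the two vertices is complete to `A`. -/
lemma isModule_of_house_free (hfree : Free P5ᶜ G) {v w : V} {A K : Finset V}
    (hv : ∀ a ∈ A, G.Adj v a) (hvw : ¬ G.Adj v w) (hK : Indecomposable G K)
    (hKm : IsModule G (nbrsIn G w A) K) : IsModule G A K := by
  have hKw : ∀ u ∈ K, u ∈ A ∧ G.Adj w u := fun u hu => mem_filter.1 (hKm.1 hu)
  refine ⟨fun u hu => (hKw u hu).1, fun p hp hpK => ?_⟩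
  by_cases hwp : G.Adj w p
  · exact hKm.2 p (mem_filter.2 ⟨hp, hwp⟩) hpK
  by_contra! hcon
  obtain ⟨⟨b, hb, hpb⟩, ⟨a, ha, hpa⟩⟩ := hcon
  have hnc : ¬ CompletePair G (K.filter (G.Adj p)) (K \ K.filter (G.Adj p)) := by
    intro hc
    rcases hK.2 _ (filter_subset _ _) (Or.inl hc) with h0 | h0
    · exact (notMem_empty a) (h0 ▸ mem_filter.2 ⟨ha, hpa⟩)
    · exact hpb (mem_filter.1 (h0.symm ▸ hb : b ∈ K.filter (G.Adj p))).2
  simp only [CompletePair, not_forall] at hnc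
  obtain ⟨a, ha, b, hb, hab⟩ := hnc
  simp only [mem_filter, mem_sdiff, not_and] at ha hb
  obtain ⟨ha, hpa⟩ := ha
  obtain ⟨hb, hpb⟩ := hb
  have hpb := hpb hb
  have hva := hv a (hKw a ha).1
  have hvb := hv b (hKw b hb).1
  have hvp := hv p hp
  have hwa := (hKw a ha).2
  have hwb := (hKw b hb).2
  have hne : v ≠ w ∧ v ≠ p ∧ v ≠ b ∧ v ≠ a ∧ w ≠ p ∧ w ≠ b ∧ w ≠ a ∧ p ≠ b ∧ p ≠ a ∧ b ≠ a := by
    refine ⟨?_, hvp.ne, hvb.ne, hva.ne, ?_, hwb.ne, hwa.ne, ?_, hpa.ne, ?_⟩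
    · rintro rfl; exact hwp hvp
    · rintro rfl; exact hvw hvp
    · rintro rfl; exact hpK hb
    · rintro rfl; exact hpb hpa
  obtain ⟨n1, n2, n3, n4, n5, n6, n7, n8, n9, n10⟩ := hne
  refine hfree ⟨![v, w, p, b, a], ?_, ?_⟩
  · intro i j hij
    fin_cases i <;> fin_cases j <;> simp_all
  · intro i j
    fin_cases i <;> fin_cases j <;>
      simp_all [P5, SimpleGraph.pathGraph_adj, G.adj_comm]

/-- A sum of sizes is bounded by `c` if the smallest size of any `j` terms is
at most `c / (j * (j + 1))`. -/
lemma sum_card_le_of_exists_small (c : ℝ) (n : ℕ) :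
    ∀ F : Finset (Finset V), F.card = n →
      (∀ F' ⊆ F, F'.Nonempty →
        ∃ M ∈ F', (M.card : ℝ) ≤ c / ((F'.card : ℝ) * ((F'.card : ℝ) + 1))) →
      ∑ M ∈ F, (M.card : ℝ) ≤ c - c / ((n : ℝ) + 1) := by
  induction n with
  | zero =>
    intro F hF _
    rw [card_eq_zero] at hF
    simp [hF]
  | succ n ih =>
    intro F hF h
    obtain ⟨M, hM, hMc⟩ := h F (Subset.refl _) (card_pos.1 (by omega))
    have h1 := ih (F.erase M) (by rw [card_erase_of_mem hM, hF]; rfl)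
      (fun F' hF' => h F' (hF'.trans (erase_subset _ _)))
    rw [← add_sum_erase _ _ hM]
    rw [hF] at hMc
    have h2 : c / (((n + 1 : ℕ) : ℝ) * (((n + 1 : ℕ) : ℝ) + 1)) =
        c / ((n : ℝ) + 1) - c / (((n + 1 : ℕ) : ℝ) + 1) := by
      push_cast
      have : (n : ℝ) + 1 ≠ 0 := by positivity
      have : (n : ℝ) + 1 + 1 ≠ 0 := by positivity
      field_simp
      ring
    linarith

lemma one_div_pow_near {x : ℝ} (hx : 0 < x) (hx1 : x ≤ 1) :
    ∃ d : ℕ, 1 / x ≤ 2 ^ d ∧ (2 : ℝ) ^ d * x ≤ 2 := by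
  obtain ⟨n, hn1, hn2⟩ := exists_nat_pow_near (one_le_one_div hx hx1) (one_lt_two (α := ℝ))
  refine ⟨n + 1, hn2.le, ?_⟩
  rw [le_div_iff₀ hx] at hn1
  rw [pow_succ]
  linarith

/-- A large set `A` of neighbours of `v` includes a set `D` of at least half its size to which all
nonneighbours of `v` and of a few further vertices are sparse, if pure blockades are excluded. -/
lemma exists_sparse_target [Fintype V] (hfree : Free P5ᶜ G) {x q : ℝ} (hx : 0 < x)
    (hq : 4 ≤ q) (hxq : x * q ^ 4 ≤ 1) {v : V} {A : Finset V} (hv : ∀ a ∈ A, G.Adj v a)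
    (hV : 0 < Fintype.card V) (hA : (Fintype.card V : ℝ) ≤ q ^ 16 * A.card)
    (hno : ∀ F, PureFamily G F → ∀ k : ℝ, q ≤ k → k ≤ 1 / x → k ≤ F.card →
      ∃ M ∈ F, (M.card : ℝ) * k ^ 30 < Fintype.card V) :
    ∃ D R : Finset V, D ⊆ A ∧ (A.card : ℝ) / 2 ≤ D.card ∧ (R.card : ℝ) ≤ 2 * (q * (q + 1)) ∧
      ∀ w, ¬ G.Adj v w → (∀ r ∈ R, ¬ G.Adj w r) →
        ((nbrsIn G w D).card : ℝ) ≤ x * (D.card : ℝ) := by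
  have hq0 : 0 < q := by linarith
  have hV' : (0 : ℝ) < Fintype.card V := by exact_mod_cast hV
  have hA0 : (0 : ℝ) < A.card := by
    by_contra! h
    have : q ^ 16 * (A.card : ℝ) ≤ 0 := mul_nonpos_of_nonneg_of_nonpos (by positivity) h
    linarith
  have hq4 : (256 : ℝ) ≤ q ^ 4 := by
    calc (256 : ℝ) = 4 ^ 4 := by norm_num
      _ ≤ q ^ 4 := by gcongr
  have hqx : q ≤ 1 / x := by
    rw [le_div_iff₀ hx]
    have : q ≤ q ^ 4 := le_self_pow₀ (by linarith) (by norm_num)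
    nlinarith
  have hx1 : x ≤ 1 / 256 := by nlinarith
  obtain ⟨R, -, hRc, hR⟩ := exists_hitting_set G A ((A.card : ℝ) / (2 * (q * (q + 1))))
  obtain ⟨F, hF, hFok, hFmax⟩ := exists_pureFamily_avoiding G A R
  set N := F.filter fun M => (Fintype.card V : ℝ) ≤ M.card * (1 / x) ^ 30 with hN
  have hFt : ∀ M ∈ F, (M.card : ℝ) ≤ (A.card : ℝ) / (2 * (q * (q + 1))) := by
    intro M hM
    by_contra! hlt
    obtain ⟨r, hr, hrM⟩ := hR M (hFok M hM).1 (hFok M hM).2.1 hlt.le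
    exact disjoint_left.1 (hFok M hM).2.2 hrM hr
  have hsum : ∑ M ∈ N, (M.card : ℝ) ≤ (A.card : ℝ) / 2 := by
    have h := sum_card_le_of_exists_small ((A.card : ℝ) / 2) N.card N rfl (by
      intro F' hF' hne
      set j : ℝ := (F'.card : ℝ) with hj
      have hj0 : 0 < j := Nat.cast_pos.2 hne.card_pos
      by_cases hjq : j < q
      · obtain ⟨M, hM⟩ := hne
        refine ⟨M, hM, (hFt M (mem_filter.1 (hF' hM)).1).trans ?_⟩
        rw [div_div]
        gcongr
      · push Not at hjq
        obtain ⟨M, hM, hMk⟩ := hno F' (fun X hX Y hY => hF X (mem_filter.1 (hF' hX)).1 Y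
          (mem_filter.1 (hF' hY)).1) (min j (1 / x)) (le_min hjq hqx) (min_le_right _ _)
          (min_le_left _ _)
        refine ⟨M, hM, ?_⟩
        rcases min_choice j (1 / x) with hmin | hmin
        · rw [hmin] at hMk
          rw [le_div_iff₀ (by positivity)]
          have hj16 : q ^ 16 ≤ j ^ 16 := by gcongr
          have h4 : 4 ≤ j := hq.trans hjq
          have h12 : (2 : ℝ) * (j * (j + 1)) ≤ j ^ 14 := by
            have h1 : (4 : ℝ) ^ 12 ≤ j ^ 12 := by gcongr
            have h2 : j ^ 14 = j ^ 12 * j ^ 2 := by ring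
            have h3 : (4 : ℝ) ^ 12 * j ^ 2 ≤ j ^ 12 * j ^ 2 := by gcongr
            norm_num at h3
            nlinarith
          have h5 : (M.card : ℝ) * j ^ 14 * j ^ 16 ≤ A.card * j ^ 16 := by
            have : q ^ 16 * (A.card : ℝ) ≤ j ^ 16 * A.card := by gcongr
            nlinarith
          have h6 : (M.card : ℝ) * j ^ 14 ≤ A.card := le_of_mul_le_mul_right h5 (by positivity)
          have h7 : (M.card : ℝ) * (2 * (j * (j + 1))) ≤ M.card * j ^ 14 := by gcongr
          linarith
        · rw [hmin] at hMk
          exact absurd (mem_filter.1 (hF' hM)).2 (not_le.2 hMk))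
    have : 0 ≤ (A.card : ℝ) / 2 / ((N.card : ℝ) + 1) := by positivity
    linarith
  have hNA : N.biUnion id ⊆ A := biUnion_subset.2 fun M hM =>
    (hFok M (mem_filter.1 hM).1).2.1.1
  have hDc : (A.card : ℝ) / 2 ≤ ((A \ N.biUnion id).card : ℝ) := by
    have h1 : ((N.biUnion id).card : ℝ) ≤ ∑ M ∈ N, (M.card : ℝ) := by
      exact_mod_cast (card_biUnion_le (s := N) (t := id))
    rw [cast_card_sdiff hNA]
    linarith
  refine ⟨A \ N.biUnion id, R, sdiff_subset, hDc, ?_, ?_⟩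
  · have h0 : (0 : ℝ) < 2 * (q * (q + 1)) := by positivity
    rw [← mul_div_assoc, div_le_iff₀ h0, mul_comm] at hRc
    exact le_of_mul_le_mul_left hRc hA0
  intro w hvw hw
  set D := A \ N.biUnion id with hD
  have hDA : D ⊆ A := sdiff_subset
  by_contra! hlt
  have hnb : nbrsIn G w D = nbrsIn G w A ∩ D := by
    ext u
    simp only [nbrsIn, mem_filter, mem_inter]
    exact ⟨fun h => ⟨⟨hDA h.1, h.2⟩, h.1⟩, fun h => ⟨h.2, h.1.2⟩⟩
  rw [hnb] at hlt
  obtain ⟨d, hd1, hd2⟩ := one_div_pow_near hx (by linarith)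
  set W : ℝ := ((nbrsIn G w A ∩ D).card : ℝ) with hW
  have h4d : (4 : ℝ) ^ d = 2 ^ d * 2 ^ d := by
    rw [← mul_pow]
    norm_num
  have hW0 : 0 < W := lt_of_le_of_lt (by positivity) hlt
  have hm0 : 0 < W / 4 ^ d := by positivity
  have hbig : (Fintype.card V : ℝ) ≤ W / 4 ^ d * (1 / x) ^ 30 := by
    have e1 : x ^ 4 * q ^ 16 ≤ 1 := by
      have : x ^ 4 * q ^ 16 = (x * q ^ 4) ^ 4 := by ring
      rw [this]
      exact pow_le_one₀ (by positivity) hxq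
    have e2 : x ^ 4 * (Fintype.card V : ℝ) ≤ A.card := by
      calc x ^ 4 * (Fintype.card V : ℝ) ≤ x ^ 4 * (q ^ 16 * A.card) := by gcongr
        _ = x ^ 4 * q ^ 16 * A.card := by ring
        _ ≤ 1 * A.card := by gcongr
        _ = A.card := one_mul _
    have e3 : x ^ 5 * (Fintype.card V : ℝ) ≤ 2 * W := by
      calc x ^ 5 * (Fintype.card V : ℝ) = x * (x ^ 4 * Fintype.card V) := by ring
        _ ≤ x * A.card := by gcongr
        _ = 2 * (x * (A.card / 2)) := by ring
        _ ≤ 2 * (x * D.card) := by gcongr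
        _ ≤ 2 * W := by linarith
    have e4 : (4 : ℝ) ^ d * x ^ 2 ≤ 4 := by
      have : (4 : ℝ) ^ d * x ^ 2 = (2 ^ d * x) ^ 2 := by rw [h4d]; ring
      rw [this]
      have h0 : 0 ≤ (2 : ℝ) ^ d * x := by positivity
      nlinarith
    have e5 : (8 : ℝ) * x ^ 23 ≤ 1 := by
      have : x ^ 23 ≤ x ^ 1 := pow_le_pow_of_le_one hx.le (by linarith) (by norm_num)
      linarith
    rw [div_mul_eq_mul_div, le_div_iff₀ (by positivity), one_div, inv_pow, ← div_eq_mul_inv,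
      le_div_iff₀ (by positivity)]
    calc (Fintype.card V : ℝ) * 4 ^ d * x ^ 30
        = (4 ^ d * x ^ 2) * (x ^ 5 * Fintype.card V) * x ^ 23 := by ring
      _ ≤ 4 * (2 * W) * x ^ 23 := by gcongr
      _ = W * (8 * x ^ 23) := by ring
      _ ≤ W * 1 := by gcongr
      _ = W := mul_one _
  have hsize : ∀ K : Finset V, W / 4 ^ d ≤ ((K ∩ D).card : ℝ) →
      (Fintype.card V : ℝ) ≤ K.card * (1 / x) ^ 30 := by
    intro K hK
    have : ((K ∩ D).card : ℝ) ≤ K.card := by exact_mod_cast card_le_card inter_subset_left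
    refine hbig.trans ?_
    gcongr
    linarith
  by_cases hK : ∀ K, Indecomposable G K → IsModule G (nbrsIn G w A) K →
      ((K ∩ D).card : ℝ) < W / 4 ^ d
  · obtain ⟨F', hF', hc, hs⟩ := exists_pureFamily_of_light_modules hm0 d _ hK
      (by rw [mul_div_cancel₀ _ (by positivity)])
    obtain ⟨M, hM, hMk⟩ := hno F' hF' (1 / x) hqx le_rfl
      (hd1.trans (by exact_mod_cast hc))
    exact absurd (hsize M (hs M hM).2) (not_le.2 hMk)
  · push Not at hK
    obtain ⟨K, hK1, hK2, hK3⟩ := hK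
    have hKR : Disjoint K R := disjoint_left.2 fun u hu hr =>
      hw u hr (mem_filter.1 (hK2.1 hu)).2
    obtain ⟨L, hL, hKL⟩ := hFmax K hK1 (isModule_of_house_free hfree hv hvw hK1 hK2) hKR
    have hne : (K ∩ D).Nonempty := by
      rw [← card_pos]
      exact_mod_cast hm0.trans_le hK3
    obtain ⟨u, hu⟩ := hne
    rw [mem_inter] at hu
    have hLN : L ∈ N := mem_filter.2 ⟨hL, (hsize K hK3).trans (by gcongr)⟩
    exact (mem_sdiff.1 hu.2).2 (mem_biUnion.2 ⟨L, hLN, hKL hu.1⟩)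

end Modules

/-- the second step for house-free sparse graphs. -/
theorem house_free_step_two
    (V : Type) [Fintype V] (G : SimpleGraph V) (x y : ℝ)
    (hx : 0 < x) (hxy : x ≤ y) (hy : y ≤ 1 / 2 ^ 8)
    (hsp : Sparse G ((1 / 2 ^ 8) * y ^ 3)) (hfree : Free P5ᶜ G)
    (hcard : y ^ (-(6 : ℝ)) ≤ (Fintype.card V : ℝ)) :
    (∃ S : Finset V, (1 / 2 ^ 8 : ℝ) * (Fintype.card V : ℝ) ≤ (S.card : ℝ) ∧
      SparseOn G S (2 * y ^ 4)) ∨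
    (∃ k : ℝ, y ^ (-(1/4) : ℝ) ≤ k ∧ k ≤ 1 / x ∧
      ∃ (n : ℕ) (B : Fin n → Finset V), IsBlockade B ∧ k ≤ (n : ℝ) ∧
        (∀ i, (Fintype.card V : ℝ) / k ^ (30 : ℝ) ≤ ((B i).card : ℝ)) ∧
        PureBlockade G B) ∨
    (∃ (n : ℕ) (B : Fin n → Finset V), IsBlockade B ∧ y⁻¹ ≤ (n : ℝ) ∧
      (∀ i, y ^ 6 * (Fintype.card V : ℝ) ≤ ((B i).card : ℝ)) ∧
      SparseBlockade G x B) := by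
  rw [or_iff_not_imp_left]
  intro hS
  rw [or_iff_not_imp_left]
  intro hP
  push Not at hS
  have hy0 : 0 < y := hx.trans_le hxy
  set n : ℝ := (Fintype.card V : ℝ) with hn
  have hy6 : 1 ≤ y ^ 6 * n := by
    have h : y ^ (-(6 : ℝ)) = (y ^ 6)⁻¹ := by
      rw [Real.rpow_neg hy0.le]
      norm_cast
    rw [h] at hcard
    have := mul_le_mul_of_nonneg_left hcard (by positivity : 0 ≤ y ^ 6)
    rwa [mul_inv_cancel₀ (by positivity)] at this
  have hn0 : 0 < n := by
    by_contra! h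
    have : y ^ 6 * n ≤ 0 := mul_nonpos_of_nonneg_of_nonpos (by positivity) h
    linarith
  set q : ℝ := y ^ (-(1/4) : ℝ) with hq
  have hq0 : 0 < q := by positivity
  have hq4 : y * q ^ 4 = 1 := by
    rw [hq, ← Real.rpow_natCast, ← Real.rpow_mul hy0.le]
    norm_num
    rw [Real.rpow_neg_one, mul_inv_cancel₀ hy0.ne']
  have hq4' : 4 ≤ q := by
    by_contra! h
    have h1 : q ^ 4 < 4 ^ 4 := by gcongr
    nlinarith
  have hno : ∀ F, PureFamily G F → ∀ k : ℝ, q ≤ k → k ≤ 1 / x → k ≤ F.card →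
      ∃ M ∈ F, (M.card : ℝ) * k ^ 30 < n := by
    intro F hF k hk1 hk2 hk3
    by_contra! hcon
    refine hP ⟨k, hk1, hk2, F.card, fun i => (F.equivFin.symm i : Finset V), ?_, hk3, ?_, ?_⟩
    · intro i j hij
      exact (hF _ (F.equivFin.symm i).2 _ (F.equivFin.symm j).2 (fun h => hij
        (F.equivFin.symm.injective (Subtype.ext h)))).1
    · intro i
      have hk0 : 0 < k := hq0.trans_le hk1
      have h30 : k ^ (30 : ℝ) = k ^ 30 := by norm_cast
      rw [h30, div_le_iff₀ (by positivity)]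
      exact hcon _ (F.equivFin.symm i).2
    · intro i j hij
      exact (hF _ (F.equivFin.symm i).2 _ (F.equivFin.symm j).2 (fun h => hij
        (F.equivFin.symm.injective (Subtype.ext h)))).2
  have step : ∀ S : Finset V, n / 2 ≤ S.card → ∃ D S' : Finset V, D ⊆ S ∧ S' ⊆ S ∧ Disjoint D S' ∧
      y ^ 6 * n ≤ D.card ∧ SparseTo G x D S' ∧ S.card - y / 4 * n ≤ (S'.card : ℝ) := by
    intro S hSc
    obtain ⟨v, hvS, hv⟩ : ∃ v ∈ S, 2 * y ^ 4 * (S.card : ℝ) < ((nbrsIn G v S).card : ℝ) := by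
      by_contra! h
      exact hS S (by linarith) h
    have hAc : y ^ 4 * n ≤ ((nbrsIn G v S).card : ℝ) := by
      have : 2 * y ^ 4 * (n / 2) ≤ 2 * y ^ 4 * S.card := by gcongr
      linarith
    obtain ⟨D, R, hDA, hDc, hRc, hD⟩ := exists_sparse_target hfree hx hq4'
      (by rw [← hq4]; gcongr) (v := v) (A := nbrsIn G v S)
      (fun a ha => (mem_filter.1 ha).2) (Nat.cast_pos.1 hn0) (by
        calc n = (y * q ^ 4) ^ 4 * n := by rw [hq4]; ring
          _ = q ^ 16 * (y ^ 4 * n) := by ring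
          _ ≤ q ^ 16 * _ := by gcongr) hno
    let Z := (insert v R).biUnion fun r => nbrsIn G r univ
    have hZ : (Z.card : ℝ) ≤ (2 * (q * (q + 1)) + 1) * ((1 / 2 ^ 8) * y ^ 3 * n) := by
      have h1 : (Z.card : ℝ) ≤ ∑ r ∈ insert v R, ((nbrsIn G r univ).card : ℝ) := by
        exact_mod_cast card_biUnion_le
      have h2 : ∑ r ∈ insert v R, ((nbrsIn G r univ).card : ℝ) ≤
          (insert v R).card • ((1 / 2 ^ 8) * y ^ 3 * n) :=
        sum_le_card_nsmul _ _ _ fun r _ => hsp r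
      have h3 : ((insert v R).card : ℝ) ≤ 2 * (q * (q + 1)) + 1 := by
        have : ((insert v R).card : ℝ) ≤ R.card + 1 := by exact_mod_cast card_insert_le v R
        linarith
      rw [nsmul_eq_mul] at h2
      have h4 : ((insert v R).card : ℝ) * ((1 / 2 ^ 8) * y ^ 3 * n) ≤
          (2 * (q * (q + 1)) + 1) * ((1 / 2 ^ 8) * y ^ 3 * n) := by gcongr
      linarith
    refine ⟨D, S \ Z, hDA.trans (filter_subset _ _), sdiff_subset, ?_, ?_, ?_, ?_⟩
    · rw [disjoint_left]
      intro u hu hu'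
      exact (mem_sdiff.1 hu').2 (mem_biUnion.2 ⟨v, mem_insert_self _ _,
        mem_filter.2 ⟨mem_univ _, (mem_filter.1 (hDA hu)).2⟩⟩)
    · have h2 : y ^ 2 ≤ 1 / 2 := by nlinarith
      have h3 : y ^ 2 * (y ^ 4 * n) ≤ 1 / 2 * (y ^ 4 * n) := by gcongr
      have h4 : y ^ 6 * n = y ^ 2 * (y ^ 4 * n) := by ring
      linarith
    · intro w hw
      have hwZ : ∀ r ∈ insert v R, ¬ G.Adj r w := fun r hr hrw =>
        (mem_sdiff.1 hw).2 (mem_biUnion.2 ⟨r, hr, mem_filter.2 ⟨mem_univ _, hrw⟩⟩)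
      exact hD w (hwZ v (mem_insert_self _ _)) fun r hr h =>
        hwZ r (mem_insert_of_mem hr) h.symm
    · have h1 : (S.card : ℝ) ≤ (S \ Z).card + Z.card := by
        exact_mod_cast card_le_card_sdiff_add_card
      have h2 : 2 * (q * (q + 1)) + 1 ≤ q ^ 4 := by
        have : 16 ≤ q ^ 2 := by nlinarith
        have : 16 * q ^ 2 ≤ q ^ 2 * q ^ 2 := by gcongr
        nlinarith
      have h3 : (2 * (q * (q + 1)) + 1) * ((1 / 2 ^ 8) * y ^ 3 * n) ≤ y / 4 * n := by
        calc (2 * (q * (q + 1)) + 1) * ((1 / 2 ^ 8) * y ^ 3 * n)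
            ≤ q ^ 4 * ((1 / 2 ^ 8) * y ^ 3 * n) := by gcongr
          _ = (y * q ^ 4) * ((1 / 2 ^ 8) * y * n * y) := by ring
          _ = (1 / 2 ^ 8) * y * n * y := by rw [hq4, one_mul]
          _ ≤ (1 / 2 ^ 8) * y * n * 1 := by gcongr; linarith
          _ ≤ y / 4 * n := by nlinarith [mul_pos hy0 hn0]
      linarith
  have build : ∀ j : ℕ, (j : ℝ) * y ≤ 2 → ∃ (B : ℕ → Finset V) (S : Finset V),
      n - j * (y / 4 * n) ≤ S.card ∧
      (∀ i < j, y ^ 6 * n ≤ (B i).card ∧ Disjoint (B i) S ∧ SparseTo G x (B i) S) ∧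
      (∀ i < j, ∀ i' < i, Disjoint (B i') (B i) ∧ SparseTo G x (B i') (B i)) := by
    intro j
    induction j with
    | zero => exact fun _ => ⟨fun _ => ∅, univ, by simp [hn], by simp, by simp⟩
    | succ j ih =>
      intro hj
      push_cast at hj
      obtain ⟨B, S, hSc, hB, hBB⟩ := ih (by linarith)
      obtain ⟨D, S', hDS, hS'S, hDS', hDc, hDsp, hS'c⟩ := step S (by nlinarith)
      refine ⟨Function.update B j D, S', ?_, ?_, ?_⟩
      · push_cast
        linarith
      · intro i hi
        rcases Nat.lt_succ_iff_lt_or_eq.1 hi with hi | rfl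
        · rw [Function.update_of_ne hi.ne]
          exact ⟨(hB i hi).1, (hB i hi).2.1.mono_right hS'S, fun w hw =>
            (hB i hi).2.2 w (hS'S hw)⟩
        · rw [Function.update_self]
          exact ⟨hDc, hDS', hDsp⟩
      · intro i hi i' hi'
        rcases Nat.lt_succ_iff_lt_or_eq.1 hi with hi | rfl
        · rw [Function.update_of_ne hi.ne, Function.update_of_ne (hi'.trans hi).ne]
          exact hBB i hi i' hi'
        · rw [Function.update_self, Function.update_of_ne hi'.ne]
          exact ⟨(hB i' hi').2.1.mono_right hDS, fun w hw => (hB i' hi').2.2 w (hDS hw)⟩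
  have hceil : (⌈y⁻¹⌉₊ : ℝ) * y ≤ 2 := by
    have h1 := (Nat.ceil_lt_add_one (inv_nonneg.2 hy0.le)).le
    calc (⌈y⁻¹⌉₊ : ℝ) * y ≤ (y⁻¹ + 1) * y := by gcongr
      _ = 1 + y := by field_simp
      _ ≤ 2 := by linarith
  obtain ⟨B, _, _, hB, hBB⟩ := build ⌈y⁻¹⌉₊ hceil
  refine ⟨⌈y⁻¹⌉₊, fun i => B i, ?_, Nat.le_ceil _, fun i => (hB i i.2).1, fun i j hij =>
    (hBB j j.2 i hij).2⟩
  intro i j hij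
  rcases lt_or_gt_of_ne hij with h | h
  · exact (hBB j j.2 i h).1
  · exact (hBB i i.2 j h).1.symm
end

section
/- Let c = 2^{-8}. Let x ∈ (0, c⁵), and let G be a c^{16}-sparse graph with no copy of the complement of P5 and with |G| ≥ x^{-7}. Then either: (1) for some real k with 1/c ≤ k ≤ 1/x, there is a pure (k, |G|/k^{34})-blockade in G; or (2) for some y with x ≤ y ≤ c⁵, there is an x-sparse (y^{-1}, y⁷·|G|)-blockade in G. -/
open Finset
open scoped Classical

/-- The vertices of `A` whose only neighbour in `Q` is `r`. -/
noncomputable def privateNbrs {V : Type*} (G : SimpleGraph V) (Q A : Finset V) (r : V) :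
    Finset V :=
  A.filter (fun a => G.Adj r a ∧ ∀ q ∈ Q, G.Adj q a → q = r)

/-- `X` cannot be split into two nonempty parts that are complete to each other. -/
def Anticonnected {V : Type*} (G : SimpleGraph V) (X : Finset V) : Prop :=
  ∀ Y ⊆ X, Y.Nonempty → (X \ Y).Nonempty → ¬ CompletePair G Y (X \ Y)

lemma nbrsIn_mono {V : Type*} (G : SimpleGraph V) (v : V) {A B : Finset V} (h : A ⊆ B) :
    (nbrsIn G v A).card ≤ (nbrsIn G v B).card :=
  card_le_card (filter_subset_filter _ h)

lemma privateNbrs_mono {V : Type*} (G : SimpleGraph V) (Q : Finset V) (r : V) {A B : Finset V}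
    (h : A ⊆ B) : (privateNbrs G Q A r).card ≤ (privateNbrs G Q B r).card :=
  card_le_card (filter_subset_filter _ h)

lemma privateNbrs_card_le {V : Type*} (G : SimpleGraph V) (Q A : Finset V) (r : V) :
    (privateNbrs G Q A r).card ≤ (nbrsIn G r A).card := by
  refine card_le_card fun a ha => ?_
  rw [privateNbrs, mem_filter] at ha
  exact mem_filter.2 ⟨ha.1, ha.2.1⟩

/-- Choosing `Q` to maximise the number of vertices it covers minus `t * |Q|` gives every member of
`Q` many private neighbours, while every vertex of `R` has few uncovered neighbours. -/
lemma exists_private_cover {V : Type*} (G : SimpleGraph V) (R A : Finset V) {t D : ℝ}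
    (ht : 0 ≤ t) (hD : ∀ r ∈ R, ((nbrsIn G r A).card : ℝ) ≤ D) :
    ∃ Q ⊆ R, ∃ U ⊆ A, (∀ r ∈ R, ((nbrsIn G r U).card : ℝ) ≤ t) ∧
      (∀ r ∈ Q, t ≤ ((privateNbrs G Q A r).card : ℝ)) ∧
      (A.card : ℝ) ≤ Q.card * D + U.card := by
  set cov : Finset V → Finset V := fun Q => A.filter (fun a => ∃ q ∈ Q, G.Adj q a) with hcov
  obtain ⟨Q, hQR, hmax⟩ := exists_max_image R.powerset
    (fun Q => ((cov Q).card : ℝ) - t * Q.card) ⟨∅, empty_mem_powerset R⟩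
  rw [mem_powerset] at hQR
  refine ⟨Q, hQR, A.filter (fun a => ∀ q ∈ Q, ¬ G.Adj q a), filter_subset _ _, ?_, ?_, ?_⟩
  · intro r hr
    by_cases hrQ : r ∈ Q
    · have : nbrsIn G r (A.filter (fun a => ∀ q ∈ Q, ¬ G.Adj q a)) = ∅ := by
        ext a
        simp only [nbrsIn, mem_filter, notMem_empty, iff_false]
        exact fun h => h.1.2 r hrQ h.2
      simpa [this] using ht
    · have h1 := hmax (insert r Q) (by
        rw [mem_powerset]; exact insert_subset hr hQR)
      have h2 : (cov Q).card + (nbrsIn G r (A.filter (fun a => ∀ q ∈ Q, ¬ G.Adj q a))).card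
          ≤ (cov (insert r Q)).card := by
        rw [← card_union_of_disjoint]
        · apply card_le_card
          intro a
          simp only [hcov, nbrsIn, mem_union, mem_filter, mem_insert]
          rintro (⟨h, q, hq, hqa⟩ | ⟨⟨h, _⟩, h'⟩)
          · exact ⟨h, q, Or.inr hq, hqa⟩
          · exact ⟨h, r, Or.inl rfl, h'⟩
        · rw [disjoint_left]
          simp only [hcov, nbrsIn, mem_filter]
          rintro a ⟨_, q, hq, hqa⟩ ⟨⟨_, h⟩, _⟩
          exact h q hq hqa
      have h3 : ((cov Q).card : ℝ)
          + (nbrsIn G r (A.filter (fun a => ∀ q ∈ Q, ¬ G.Adj q a))).card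
          ≤ (cov (insert r Q)).card := by exact_mod_cast h2
      simp only [card_insert_of_notMem hrQ, Nat.cast_add, Nat.cast_one] at h1
      linarith
  · intro r hr
    have h1 := hmax (Q.erase r) (by
      rw [mem_powerset]; exact (erase_subset _ _).trans hQR)
    have h2 : (cov Q).card ≤ (cov (Q.erase r)).card + (privateNbrs G Q A r).card := by
      refine (card_le_card ?_).trans (card_union_le _ _)
      intro a
      simp only [hcov, privateNbrs, mem_union, mem_filter, mem_erase]
      rintro ⟨h, q, hq, hqa⟩
      by_cases hp : ∃ q', (q' ≠ r ∧ q' ∈ Q) ∧ G.Adj q' a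
      · exact Or.inl ⟨h, hp⟩
      · push Not at hp
        have hall : ∀ q ∈ Q, G.Adj q a → q = r := fun q hq hqa => by
          by_contra hne
          exact hp q ⟨hne, hq⟩ hqa
        have := hall q hq hqa
        subst this
        exact Or.inr ⟨h, hqa, hall⟩
    have h3 : ((cov Q).card : ℝ) ≤ (cov (Q.erase r)).card + (privateNbrs G Q A r).card := by
      exact_mod_cast h2
    have h4 : (Q.card : ℝ) = (Q.erase r).card + 1 := by
      exact_mod_cast (card_erase_add_one hr).symm
    simp only [h4] at h1
    linarith
  · have h1 : A.card ≤ ∑ q ∈ Q, (nbrsIn G q A).card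
        + (A.filter (fun a => ∀ q ∈ Q, ¬ G.Adj q a)).card := by
      refine le_trans (card_le_card ?_) ((card_union_le _ _).trans
        (Nat.add_le_add_right (card_biUnion_le (s := Q) (t := fun q => nbrsIn G q A)) _))
      intro a ha
      simp only [nbrsIn, mem_union, mem_biUnion, mem_filter]
      by_cases h : ∃ q ∈ Q, G.Adj q a
      · obtain ⟨q, hq, hqa⟩ := h
        exact Or.inl ⟨q, hq, ha, hqa⟩
      · push Not at h
        exact Or.inr ⟨ha, h⟩
    have h2 : (A.card : ℝ) ≤ ∑ q ∈ Q, ((nbrsIn G q A).card : ℝ)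
        + (A.filter (fun a => ∀ q ∈ Q, ¬ G.Adj q a)).card := by exact_mod_cast h1
    have h3 : ∑ q ∈ Q, ((nbrsIn G q A).card : ℝ) ≤ Q.card * D := by
      rw [← nsmul_eq_mul]
      exact sum_le_card_nsmul _ _ _ fun q hq => hD q (hQR hq)
    linarith

/-- If `A` is well covered by `R` but no vertex of `R` has more than `d ^ 2` neighbours in `A`,
then there is a large comb with apexes in `R` and blocks in `A`. -/
lemma exists_comb {V : Type*} (G : SimpleGraph V) (R : Finset V) {e₀ γ μ : ℝ}
    (hγ : 0 < γ) (m : ℕ) :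
    ∀ (A : Finset V) (d : ℝ), 0 < d → d ≤ 2 ^ m * e₀ →
      (∀ r ∈ R, ((nbrsIn G r A).card : ℝ) ≤ d ^ 2) →
      (∀ U ⊆ A, (∀ r ∈ R, ((nbrsIn G r U).card : ℝ) ≤ e₀ ^ 2) → (U.card : ℝ) ≤ μ) →
      4 * γ * d + μ < A.card →
      ∃ Q ⊆ R, ∃ e : ℝ, e₀ / 2 ≤ e ∧ γ ≤ Q.card * e ∧
        ∀ r ∈ Q, e ^ 2 ≤ ((privateNbrs G Q A r).card : ℝ) := by
  have small : ∀ (A : Finset V) (d : ℝ), 0 < d → d ≤ e₀ →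
      (∀ r ∈ R, ((nbrsIn G r A).card : ℝ) ≤ d ^ 2) →
      (∀ U ⊆ A, (∀ r ∈ R, ((nbrsIn G r U).card : ℝ) ≤ e₀ ^ 2) → (U.card : ℝ) ≤ μ) →
      ¬ 4 * γ * d + μ < A.card := by
    intro A d hd hde hdeg hμ hA
    have := hμ A (Subset.refl _) fun r hr => (hdeg r hr).trans (by gcongr)
    have : 0 < γ * d := by positivity
    linarith
  induction m with
  | zero =>
    intro A d hd hde hdeg hμ hA
    exact absurd hA (small A d hd (by simpa using hde) hdeg hμ)
  | succ m ih =>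
    intro A d hd hde hdeg hμ hA
    by_cases hsm : d ≤ e₀
    · exact absurd hA (small A d hd hsm hdeg hμ)
    push Not at hsm
    obtain ⟨Q, hQR, U, hUA, hU, hQ, hcard⟩ :=
      exists_private_cover G R A (t := (d / 2) ^ 2) (by positivity) hdeg
    by_cases hk : γ ≤ Q.card * (d / 2)
    · exact ⟨Q, hQR, d / 2, by linarith, hk, hQ⟩
    push Not at hk
    have hUc : 4 * γ * (d / 2) + μ < U.card := by
      nlinarith
    obtain ⟨Q', hQ', e, he, hQe, hpr⟩ := ih U (d / 2) (by positivity)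
      (by rw [pow_succ] at hde; linarith) hU (fun W hW => hμ W (hW.trans hUA)) hUc
    exact ⟨Q', hQ', e, he, hQe, fun r hr =>
      (hpr r hr).trans (by exact_mod_cast privateNbrs_mono G Q' r hUA)⟩

/-- A set without large anticonnected subsets contains a long complete blockade. -/
lemma exists_complete_blockade {V : Type*} (G : SimpleGraph V) {w : ℝ} (hw : 0 ≤ w) (L : ℕ) :
    ∀ X : Finset V, (∀ Y ⊆ X, w ≤ Y.card → ¬ Anticonnected G Y) → 2 * w * L ≤ X.card →
      ∃ B : Fin L → Finset V, IsBlockade B ∧ (∀ i, B i ⊆ X) ∧ (∀ i, w ≤ ((B i).card : ℝ)) ∧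
        CompleteBlockade G B := by
  induction L with
  | zero =>
    intro X _ _
    exact ⟨fun _ => ∅, fun i => i.elim0, fun i => i.elim0, fun i => i.elim0, fun i => i.elim0⟩
  | succ L ih =>
    intro X hX hcard
    push_cast at hcard
    have hL : 0 ≤ w * L := by positivity
    obtain ⟨Y, hY, hmin⟩ := exists_min_image
      (X.powerset.filter (fun Y => w ≤ Y.card ∧ CompletePair G Y (X \ Y))) Finset.card
      ⟨X, by
        simp only [mem_filter, mem_powerset, Subset.refl, true_and]
        exact ⟨by linarith, fun a _ b hb => by simp at hb⟩⟩
    simp only [mem_filter, mem_powerset] at hY hmin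
    obtain ⟨hYX, hYw, hYc⟩ := hY
    have hYs : (Y.card : ℝ) ≤ 2 * w := by
      by_contra! hlt
      have hna := hX Y hYX hYw
      simp only [Anticonnected, not_forall, not_not] at hna
      obtain ⟨Z, hZY, hZn, hZn', hZc⟩ := hna
      have hsum : ((Y \ Z).card : ℝ) + Z.card = Y.card := by
        exact_mod_cast card_sdiff_add_card_eq_card hZY
      have hsumn := card_sdiff_add_card_eq_card hZY
      have p1 := hZn.card_pos
      have p2 := hZn'.card_pos
      rcases le_total w (Z.card : ℝ) with h | h
      · have := hmin Z ⟨hZY.trans hYX, h, fun a ha b hb => by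
          rw [mem_sdiff] at hb
          by_cases hbY : b ∈ Y
          · exact hZc a ha b (mem_sdiff.2 ⟨hbY, hb.2⟩)
          · exact hYc a (hZY ha) b (mem_sdiff.2 ⟨hb.1, hbY⟩)⟩
        omega
      · have := hmin (Y \ Z) ⟨sdiff_subset.trans hYX, by linarith, fun a ha b hb => by
          rw [mem_sdiff] at hb
          have ha' := mem_sdiff.1 ha
          by_cases hbY : b ∈ Y
          · have hbZ : b ∈ Z := by
              by_contra hbZ
              exact hb.2 (mem_sdiff.2 ⟨hbY, hbZ⟩)
            exact (hZc b hbZ a ha).symm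
          · exact hYc a ha'.1 b (mem_sdiff.2 ⟨hb.1, hbY⟩)⟩
        omega
    have hsum : ((X \ Y).card : ℝ) + Y.card = X.card := by
      exact_mod_cast card_sdiff_add_card_eq_card hYX
    obtain ⟨B, hB, hBX, hBw, hBc⟩ := ih (X \ Y)
      (fun Z hZ => hX Z (hZ.trans sdiff_subset)) (by linarith)
    have hdis : ∀ i, Disjoint Y (B i) := fun i =>
      disjoint_sdiff.mono_right (hBX i)
    refine ⟨Fin.cons Y B, ?_, ?_, ?_, ?_⟩
    · intro i j
      refine Fin.cases ?_ (fun i => ?_) i <;> refine Fin.cases ?_ (fun j => ?_) j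
      · intro h; exact absurd rfl h
      · intro _; simpa using hdis j
      · intro _; simpa using (hdis i).symm
      · intro h; simpa using hB i j (by simpa using h)
    · intro i
      refine Fin.cases ?_ (fun i => ?_) i
      · simpa using hYX
      · simpa using (hBX i).trans sdiff_subset
    · intro i
      refine Fin.cases ?_ (fun i => ?_) i
      · simpa using hYw
      · simpa using hBw i
    · intro i j
      refine Fin.cases ?_ (fun i => ?_) i <;> refine Fin.cases ?_ (fun j => ?_) j
      · intro h; exact absurd rfl h
      · intro _ a ha b hb
        exact hYc a (by simpa using ha) b (hBX j (by simpa using hb))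
      · intro _ a ha b hb
        exact (hYc b (by simpa using hb) a (hBX i (by simpa using ha))).symm
      · intro h; simpa using hBc i j (by simpa using h)

/-- In a house-free graph, no vertex attaches to exactly two consecutive vertices of an induced
four-cycle. -/
lemma not_adj_of_house_free {V : Type*} {G : SimpleGraph V} (hfree : Free P5ᶜ G)
    {v r u a a' : V} (hva : G.Adj v a) (hva' : G.Adj v a') (hvu : G.Adj v u) (hra : G.Adj r a)
    (hra' : G.Adj r a') (hvr : ¬ G.Adj v r) (hru : ¬ G.Adj r u) (haa : ¬ G.Adj a a')
    (hua : G.Adj u a) : G.Adj u a' := by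
  by_contra hua'
  have n1 : v ≠ r := by rintro rfl; exact hru hvu
  have n2 : r ≠ u := by rintro rfl; exact hvr hvu
  have n3 : u ≠ a' := by rintro rfl; exact hru hra'
  have n4 : a' ≠ a := by rintro rfl; exact hua' hua
  apply hfree
  refine ⟨![v, r, u, a', a], ?_, ?_⟩
  · intro i j hij
    fin_cases i <;> fin_cases j <;>
      simp_all [hva.ne, hva.ne', hva'.ne, hva'.ne', hvu.ne, hvu.ne', hra.ne, hra.ne', hra'.ne,
        hra'.ne', hua.ne, hua.ne', n1.symm, n2.symm, n3.symm, n4.symm]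
  · intro i j
    fin_cases i <;> fin_cases j <;>
      simp [P5, SimpleGraph.pathGraph_adj, G.adj_comm] <;>
      simp_all

/-- In a house-free graph, two anticonnected blocks of a comb inside the neighbourhood of `v`,
with apexes nonadjacent to `v`, form a pure pair. -/
lemma complete_or_anticomplete {V : Type*} {G : SimpleGraph V} (hfree : Free P5ᶜ G) {v r s : V}
    {X Y : Finset V} (hX : Anticonnected G X) (hY : Anticonnected G Y)
    (hvX : ∀ a ∈ X, G.Adj v a) (hvY : ∀ a ∈ Y, G.Adj v a) (hvr : ¬ G.Adj v r)
    (hvs : ¬ G.Adj v s) (hrX : ∀ a ∈ X, G.Adj r a) (hrY : ∀ a ∈ Y, ¬ G.Adj r a)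
    (hsY : ∀ a ∈ Y, G.Adj s a) (hsX : ∀ a ∈ X, ¬ G.Adj s a) :
    CompletePair G X Y ∨ AnticompletePair G X Y := by
  have key : ∀ {r : V} {Z : Finset V} {u : V}, Anticonnected G Z → (∀ a ∈ Z, G.Adj v a) →
      ¬ G.Adj v r → (∀ a ∈ Z, G.Adj r a) → G.Adj v u → ¬ G.Adj r u →
      ∀ a ∈ Z, ∀ b ∈ Z, G.Adj u a → G.Adj u b := by
    intro r Z u hZ hvZ hvr hrZ hvu hru a ha b hb hua
    by_contra hub
    refine hZ (Z.filter (fun z => G.Adj u z)) (filter_subset _ _)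
      ⟨a, mem_filter.2 ⟨ha, hua⟩⟩
      ⟨b, mem_sdiff.2 ⟨hb, fun h => hub (mem_filter.1 h).2⟩⟩ ?_
    intro p hp q hq
    rw [mem_filter] at hp
    rw [mem_sdiff, mem_filter] at hq
    by_contra hpq
    exact hq.2 ⟨hq.1, not_adj_of_house_free hfree (hvZ p hp.1) (hvZ q hq.1) hvu (hrZ p hp.1)
      (hrZ q hq.1) hvr hru hpq hp.2⟩
  by_cases h : ∃ a ∈ X, ∃ b ∈ Y, G.Adj a b
  · left
    obtain ⟨a, ha, b, hb, hab⟩ := h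
    intro p hp q hq
    have h1 : G.Adj a q := key hY hvY hvs hsY (hvX a ha) (hsX a ha) b hb q hq hab
    exact (key hX hvX hvr hrX (hvY q hq) (hrY q hq) a ha p hp h1.symm).symm
  · right
    push Not at h
    exact h

/-- A comb inside the neighbourhood of `v`, with apexes nonadjacent to `v`, yields a pure
blockade. -/
lemma exists_pure_blockade_of_comb {V : Type*} {G : SimpleGraph V} (hfree : Free P5ᶜ G) {v : V}
    {Q A : Finset V} (hA : ∀ a ∈ A, G.Adj v a) (hQ : ∀ r ∈ Q, ¬ G.Adj v r) {w : ℝ} (hw : 0 ≤ w)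
    {L : ℕ} (hpr : ∀ r ∈ Q, 2 * w * L ≤ ((privateNbrs G Q A r).card : ℝ)) {K : ℝ}
    (hKL : K ≤ L) (hKQ : K ≤ Q.card) :
    ∃ (n : ℕ) (B : Fin n → Finset V), IsBlockade B ∧ K ≤ (n : ℝ) ∧
      (∀ i, w ≤ ((B i).card : ℝ)) ∧ PureBlockade G B := by
  by_cases h : ∃ r ∈ Q, ∀ Y ⊆ privateNbrs G Q A r, w ≤ Y.card → ¬ Anticonnected G Y
  · obtain ⟨r, hr, hY⟩ := h
    obtain ⟨B, hB, -, hBw, hBc⟩ := exists_complete_blockade G hw L _ hY (hpr r hr)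
    exact ⟨L, B, hB, hKL, hBw, fun i j hij => Or.inl (hBc i j hij)⟩
  · push Not at h
    choose! Y hYp hYw hYa using h
    have hmem : ∀ r ∈ Q, ∀ a ∈ Y r, a ∈ A ∧ G.Adj r a ∧ ∀ q ∈ Q, G.Adj q a → q = r :=
      fun r hr a ha => by simpa [privateNbrs] using hYp r hr ha
    let e := Q.equivFin
    have hne : ∀ i j, i ≠ j → ((e.symm i : V) ≠ (e.symm j : V)) := fun i j hij h =>
      hij (e.symm.injective (Subtype.ext h))
    refine ⟨Q.card, fun i => Y (e.symm i), ?_, hKQ, fun i => hYw _ (e.symm i).2, ?_⟩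
    · intro i j hij
      rw [disjoint_left]
      intro a hai haj
      exact hne i j hij ((hmem _ (e.symm j).2 a haj).2.2 _ (e.symm i).2
        (hmem _ (e.symm i).2 a hai).2.1)
    · intro i j hij
      have hi := hmem _ (e.symm i).2
      have hj := hmem _ (e.symm j).2
      exact complete_or_anticomplete hfree (hYa _ (e.symm i).2) (hYa _ (e.symm j).2)
        (fun a ha => hA a (hi a ha).1) (fun a ha => hA a (hj a ha).1)
        (hQ _ (e.symm i).2) (hQ _ (e.symm j).2) (fun a ha => (hi a ha).2.1)
        (fun a ha hadj => hne i j hij ((hj a ha).2.2 _ (e.symm i).2 hadj))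
        (fun a ha => (hj a ha).2.1)
        (fun a ha hadj => hne j i hij.symm ((hi a ha).2.2 _ (e.symm j).2 hadj))

lemma sum_card_nbrsIn_comm {V : Type*} (G : SimpleGraph V) (A B : Finset V) :
    ∑ a ∈ A, ((nbrsIn G a B).card : ℝ) = ∑ b ∈ B, ((nbrsIn G b A).card : ℝ) := by
  have h := sum_card_bipartiteAbove_eq_sum_card_bipartiteBelow (s := A) (t := B) G.Adj
  simp only [bipartiteAbove, bipartiteBelow] at h
  simp only [nbrsIn]
  simp only [G.adj_comm] at h ⊢
  exact_mod_cast h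

/-- `G` has a pure `(k, |G| / k ^ 34)`-blockade for some `k` between `2 ^ 8` and `1 / x`. -/
def HasPureBlockade {V : Type*} [Fintype V] (G : SimpleGraph V) (x : ℝ) : Prop :=
  ∃ k : ℝ, (2 : ℝ) ^ 8 ≤ k ∧ k ≤ 1 / x ∧
    ∃ (n : ℕ) (B : Fin n → Finset V), IsBlockade B ∧ k ≤ (n : ℝ) ∧
      (∀ i, (Fintype.card V : ℝ) / k ^ (34 : ℝ) ≤ ((B i).card : ℝ)) ∧
      PureBlockade G B

/-- A sufficiently large comb inside the neighbourhood of `v`, with apexes nonadjacent to `v`,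
gives a pure blockade of controlled size. -/
lemma hasPureBlockade_of_comb {V : Type*} [Fintype V] {G : SimpleGraph V} (hfree : Free P5ᶜ G)
    {x y W e : ℝ} (hx : 0 < x) (hxy : x ≤ y) (hy : y ≤ 1 / 2 ^ 40) {v : V} {Q A : Finset V}
    (hA : ∀ a ∈ A, G.Adj v a) (hQ : ∀ r ∈ Q, ¬ G.Adj v r)
    (hpr : ∀ r ∈ Q, e ≤ ((privateNbrs G Q A r).card : ℝ))
    (hQy : 1 / y ≤ Q.card) (hW : y ^ 4 * Fintype.card V / 32 ≤ W)
    (heQ : W ≤ (Q.card : ℝ) ^ 2 * e) (hex : x * y ^ 3 * W / 256 ≤ e) :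
    HasPureBlockade G x := by
  have hy0 : 0 < y := hx.trans_le hxy
  set n : ℝ := (Fintype.card V : ℝ) with hn
  have hn0 : 0 ≤ n := by positivity
  have hK : ∃ K : ℝ, 1 / y ≤ K ∧ K ≤ 1 / x ∧ K ≤ Q.card ∧ n / K ^ 8 / 2 ^ 13 ≤ e := by
    rcases le_total (Q.card : ℝ) (1 / x) with h | h
    · refine ⟨Q.card, hQy, h, le_rfl, ?_⟩
      have hk : 0 < (Q.card : ℝ) := lt_of_lt_of_le (by positivity) hQy
      have h1 : 1 ≤ Q.card * y := by rwa [div_le_iff₀ hy0] at hQy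
      rw [div_div, div_le_iff₀ (by positivity)]
      have h2 : n ≤ (Q.card * y) ^ 4 * n := le_mul_of_one_le_left hn0 (one_le_pow₀ h1)
      have h4 : 1 ≤ (Q.card : ℝ) := by
        have : (0 : ℝ) < Q.card := hk
        exact_mod_cast (by exact_mod_cast this : 0 < Q.card)
      have h3 : (Q.card : ℝ) ^ 4 * (y ^ 4 * n / 32) ≤ (Q.card : ℝ) ^ 4 * ((Q.card : ℝ) ^ 2 * e) :=
        mul_le_mul_of_nonneg_left (hW.trans heQ) (by positivity)
      have he0 : 0 ≤ e := by
        have : 0 ≤ x * y ^ 3 * W / 256 := by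
          have : 0 ≤ W := le_trans (by positivity) hW
          positivity
        linarith
      have h5 : (Q.card : ℝ) ^ 6 * e ≤ (Q.card : ℝ) ^ 8 * e := by
        gcongr ?_ * e
        exact pow_le_pow_right₀ h4 (by norm_num)
      have h6 : 0 ≤ (Q.card : ℝ) ^ 8 * e := by positivity
      nlinarith
    · refine ⟨1 / x, by gcongr, le_rfl, h, ?_⟩
      have h1 : n / (1 / x) ^ 8 / 2 ^ 13 = x * x ^ 3 * (x ^ 4 * n / 32) / 256 := by
        field_simp
        ring
      rw [h1]
      refine le_trans ?_ hex
      have : x ^ 4 * n / 32 ≤ W := le_trans (by gcongr) hW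
      gcongr
  obtain ⟨K, hK1, hK2, hK3, hK4⟩ := hK
  have hK40 : (2 : ℝ) ^ 40 ≤ K := by
    refine le_trans ?_ hK1
    rw [le_div_iff₀ hy0]
    calc (2 : ℝ) ^ 40 * y ≤ 2 ^ 40 * (1 / 2 ^ 40) := by gcongr
      _ = 1 := by norm_num
  have hK0 : 0 < K := lt_of_lt_of_le (by norm_num) hK40
  refine ⟨K, le_trans (by norm_num) hK40, hK2, ?_⟩
  have hpow : K ^ (34 : ℝ) = K ^ 34 := by exact_mod_cast Real.rpow_natCast K 34
  rw [hpow]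
  refine exists_pure_blockade_of_comb hfree hA hQ (w := n / K ^ 34) (by positivity)
    (L := ⌈K⌉₊) (fun r hr => le_trans ?_ (hpr r hr)) (Nat.le_ceil K) hK3
  have hL : (⌈K⌉₊ : ℝ) ≤ 2 * K := by
    have := (Nat.ceil_lt_add_one hK0.le).le
    have : (1 : ℝ) ≤ K := le_trans (by norm_num) hK40
    linarith
  refine le_trans ?_ hK4
  calc 2 * (n / K ^ 34) * ⌈K⌉₊ ≤ 2 * (n / K ^ 34) * (2 * K) := by gcongr
    _ = n / K ^ 8 * (4 / K ^ 25) := by field_simp; ring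
    _ ≤ n / K ^ 8 * (1 / 2 ^ 13) := by
      gcongr n / K ^ 8 * ?_
      rw [div_le_div_iff₀ (by positivity) (by norm_num)]
      have : ((2 : ℝ) ^ 40) ^ 25 ≤ K ^ 25 := by gcongr
      refine le_trans ?_ (this.trans_eq (one_mul _).symm)
      norm_num
    _ = n / K ^ 8 / 2 ^ 13 := by ring

/-- If every vertex of `A`, inside the neighbourhood of `v`, has many neighbours among the
nonneighbours `T` of `v`, but every vertex of `T` has few neighbours in `A`, then there is a pure
blockade. -/
lemma hasPureBlockade_of_dense_pair {V : Type*} [Fintype V] {G : SimpleGraph V}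
    (hfree : Free P5ᶜ G) {x y N : ℝ} (hx : 0 < x) (hxy : x ≤ y) (hy : y ≤ 1 / 2 ^ 40)
    (hN : y * Fintype.card V ≤ N) (hN0 : 0 < N) {v : V} {A T : Finset V}
    (hvA : ∀ a ∈ A, G.Adj v a) (hvT : ∀ r ∈ T, ¬ G.Adj v r) (hTN : (T.card : ℝ) ≤ N)
    (hA : y ^ 3 * N / 32 ≤ A.card)
    (hdegT : ∀ r ∈ T, ((nbrsIn G r A).card : ℝ) ≤ 8 * y ^ 2 * A.card)
    (hdegA : ∀ a ∈ A, x * (y ^ 3 * N / 32) ≤ (nbrsIn G a T).card) :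
    HasPureBlockade G x := by
  have hy0 : 0 < y := hx.trans_le hxy
  set W : ℝ := (A.card : ℝ) with hW
  have hW0 : 0 < W := lt_of_lt_of_le (by positivity) hA
  set θ := x * (y ^ 3 * N / 32) with hθ
  have hθ0 : 0 < θ := by positivity
  set d := √(8 * W) * y with hd
  have hd0 : 0 < d := by positivity
  have hd2 : d ^ 2 = 8 * y ^ 2 * W := by
    rw [hd, mul_pow, Real.sq_sqrt (by positivity)]
    ring
  set e₀ := √(x * y ^ 3 * W / 64) with he₀
  have he₀0 : 0 < e₀ := by positivity
  have he₀2 : e₀ ^ 2 = x * y ^ 3 * W / 64 := Real.sq_sqrt (by positivity)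
  obtain ⟨m, hm⟩ := pow_unbounded_of_one_lt (d / e₀) (one_lt_two (α := ℝ))
  rw [← hd2] at hdegT
  obtain ⟨Q, hQT, e, hee, hQe, hpr⟩ := exists_comb G T (e₀ := e₀) (γ := W / (10 * d)) (μ := W / 2)
    (by positivity) m A d hd0 ((div_le_iff₀ he₀0).1 hm.le) hdegT
    (by
      intro U hU hUT
      have h1 : U.card * θ ≤ N * e₀ ^ 2 := by
        calc U.card * θ ≤ ∑ a ∈ U, ((nbrsIn G a T).card : ℝ) := by
              rw [← nsmul_eq_mul]
              exact card_nsmul_le_sum _ _ _ fun a ha => hdegA a (hU ha)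
          _ = ∑ r ∈ T, ((nbrsIn G r U).card : ℝ) := sum_card_nbrsIn_comm G U T
          _ ≤ T.card * e₀ ^ 2 := by
              rw [← nsmul_eq_mul]
              exact sum_le_card_nsmul _ _ _ hUT
          _ ≤ N * e₀ ^ 2 := by gcongr
      have h2 : U.card * θ ≤ W / 2 * θ := by
        refine h1.trans_eq ?_
        rw [he₀2, hθ]
        ring
      exact le_of_mul_le_mul_right h2 hθ0)
    (by
      have : 4 * (W / (10 * d)) * d = 2 / 5 * W := by field_simp; norm_num
      rw [this]
      linarith)
  have he0 : 0 < e := by linarith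
  have hk : W / (800 * y ^ 2) ≤ (Q.card : ℝ) ^ 2 * e ^ 2 := by
    have h1 : (W / (10 * d)) ^ 2 ≤ (Q.card * e) ^ 2 := by gcongr
    have h2 : (W / (10 * d)) ^ 2 = W / (800 * y ^ 2) := by
      rw [div_pow, mul_pow, hd2]
      field_simp
      norm_num
    rw [h2, mul_pow] at h1
    exact h1
  have hy2 : y ^ 2 ≤ (1 / 2 ^ 40) ^ 2 := by gcongr
  have hQne : Q.Nonempty := by
    rw [nonempty_iff_ne_empty]
    rintro rfl
    simp only [card_empty, Nat.cast_zero, zero_mul] at hQe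
    have : 0 < W / (10 * d) := by positivity
    linarith
  have hed : e ^ 2 ≤ 8 * y ^ 2 * W := by
    obtain ⟨r, hr⟩ := hQne
    rw [← hd2]
    refine (hpr r hr).trans (le_trans ?_ (hdegT r (hQT hr)))
    exact_mod_cast privateNbrs_card_le G Q A r
  refine hasPureBlockade_of_comb hfree (W := W) (e := e ^ 2) hx hxy hy
    hvA (fun r hr => hvT r (hQT hr)) hpr ?_ ?_ ?_ ?_
  · have h1 : W / (800 * y ^ 2) ≤ (Q.card : ℝ) ^ 2 * (8 * y ^ 2 * W) := hk.trans (by gcongr)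
    rw [div_le_iff₀ (by positivity)] at h1
    have h2 : 1 ≤ 6400 * y ^ 2 * (Q.card * y) ^ 2 := by
      have : 1 * W ≤ 6400 * y ^ 2 * (Q.card * y) ^ 2 * W := by linarith
      exact le_of_mul_le_mul_right this hW0
    rw [div_le_iff₀ hy0]
    have h3 : 6400 * y ^ 2 * (Q.card * y) ^ 2 ≤ 1 * (Q.card * y) ^ 2 := by
      gcongr
      linarith
    exact (one_le_sq_iff₀ (by positivity)).1 (by linarith)
  · have : y ^ 3 * (y * Fintype.card V) ≤ y ^ 3 * N := by gcongr
    linarith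
  · refine le_trans ?_ hk
    rw [le_div_iff₀ (by positivity)]
    have : W * (800 * y ^ 2) ≤ W * 1 := by
      gcongr
      linarith
    linarith
  · have : (e₀ / 2) ^ 2 ≤ e ^ 2 := by gcongr
    rw [div_pow, he₀2] at this
    linarith

/-- In a set `S` of bounded maximum degree with a vertex of not too small degree, we find either a
pure blockade of `G`, or a large set `A` that is sparse to almost all of `S`. -/
lemma hasPureBlockade_or_exists_sparse_pair {V : Type*} [Fintype V] {G : SimpleGraph V}
    (hfree : Free P5ᶜ G) {x y N : ℝ} (hx : 0 < x) (hxy : x ≤ y) (hy : y ≤ 1 / 2 ^ 40)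
    (hN : y * Fintype.card V ≤ N) (hN' : 1 ≤ y ^ 6 * N) {S : Finset V}
    (hS : N / 2 ≤ S.card) (hSN : (S.card : ℝ) ≤ N)
    (hdeg : ∀ s ∈ S, ((nbrsIn G s S).card : ℝ) ≤ y ^ 3 * N) {v : V} (hvS : v ∈ S)
    (hv : (y / 2) ^ 3 * S.card ≤ (nbrsIn G v S).card) :
    HasPureBlockade G x ∨ ∃ A ⊆ S, ∃ T ⊆ S, Disjoint A T ∧ y ^ 3 * N / 32 ≤ A.card ∧
      (S.card : ℝ) - y * N / 2 ≤ T.card ∧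
      ∀ a ∈ A, ((nbrsIn G a T).card : ℝ) ≤ x * (y ^ 3 * N / 32) := by
  have hy0 : 0 < y := hx.trans_le hxy
  have hN0 : 0 < N := by
    by_contra! h
    have : y ^ 6 * N ≤ 0 := mul_nonpos_of_nonneg_of_nonpos (by positivity) h
    linarith
  set A := nbrsIn G v S with hAdef
  have hAS : A ⊆ S := filter_subset _ _
  have hvA : ∀ a ∈ A, G.Adj v a := fun a ha => (mem_filter.1 ha).2
  have hAlow : y ^ 3 * N / 16 ≤ A.card := by
    refine le_trans ?_ hv
    calc y ^ 3 * N / 16 = (y / 2) ^ 3 * (N / 2) := by ring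
      _ ≤ _ := by gcongr
  have hA0 : (0 : ℝ) < A.card := lt_of_lt_of_le (by positivity) hAlow
  set X := S.filter (fun r => 4 * y ^ 2 * A.card < (nbrsIn G r A).card) with hX
  set T := S.filter (fun r => r ≠ v ∧ ¬ G.Adj v r ∧
    ((nbrsIn G r A).card : ℝ) ≤ 4 * y ^ 2 * A.card) with hT
  have hTS : T ⊆ S := filter_subset _ _
  have hXc : (X.card : ℝ) ≤ y * N / 4 := by
    have h1 : (X.card : ℝ) * (4 * y ^ 2 * A.card) ≤ A.card * (y ^ 3 * N) := by
      calc (X.card : ℝ) * (4 * y ^ 2 * A.card)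
          ≤ ∑ r ∈ X, ((nbrsIn G r A).card : ℝ) := by
            rw [← nsmul_eq_mul]
            exact card_nsmul_le_sum _ _ _ fun r hr => (mem_filter.1 hr).2.le
        _ = ∑ a ∈ A, ((nbrsIn G a X).card : ℝ) := sum_card_nbrsIn_comm G X A
        _ ≤ A.card * (y ^ 3 * N) := by
            rw [← nsmul_eq_mul]
            refine sum_le_card_nsmul _ _ _ fun a ha => le_trans ?_ (hdeg a (hAS ha))
            exact_mod_cast nbrsIn_mono G a (filter_subset _ _)
    have h2 : (X.card : ℝ) * (4 * y ^ 2 * A.card) ≤ (y * N / 4) * (4 * y ^ 2 * A.card) :=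
      h1.trans_eq (by ring)
    exact le_of_mul_le_mul_right h2 (by positivity)
  have hTc : (S.card : ℝ) - y * N / 2 ≤ T.card := by
    have h1 : S ⊆ T ∪ ({v} ∪ (A ∪ X)) := by
      intro s hs
      simp only [hT, hX, hAdef, nbrsIn, mem_union, mem_filter, mem_singleton, hs, true_and]
      by_cases h1 : s = v
      · tauto
      · by_cases h2 : G.Adj v s
        · tauto
        · rcases le_or_gt ((nbrsIn G s A).card : ℝ) (4 * y ^ 2 * A.card) with h3 | h3
          · exact Or.inl ⟨h1, h2, h3⟩
          · exact Or.inr (Or.inr (Or.inr h3))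
    have h2 : S.card ≤ T.card + (1 + (A.card + X.card)) := by
      refine (card_le_card h1).trans ((card_union_le _ _).trans ?_)
      gcongr
      refine (card_union_le _ _).trans ?_
      gcongr
      · simp
      · exact card_union_le _ _
    have h3 : (S.card : ℝ) ≤ T.card + (1 + (A.card + X.card)) := by exact_mod_cast h2
    have h4 : (A.card : ℝ) ≤ y ^ 3 * N := hdeg v hvS
    have h5 : y ^ 3 * N ≤ y * N / 8 := by
      have : y ^ 2 ≤ (1 / 2 ^ 40) ^ 2 := by gcongr
      have h6 : y ^ 2 * (y * N) ≤ 1 / 8 * (y * N) := by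
        gcongr
        exact this.trans (by norm_num)
      linarith
    have h6 : 1 ≤ y * N / 8 := by
      have : y ^ 5 ≤ (1 / 2 ^ 40) ^ 5 := by gcongr
      have h6 : y ^ 5 * (y * N) ≤ 1 / 8 * (y * N) := by
        gcongr
        exact this.trans (by norm_num)
      linarith
    linarith
  have hTN : (T.card : ℝ) ≤ N := le_trans (by exact_mod_cast card_le_card hTS) hSN
  set θ := x * (y ^ 3 * N / 32) with hθ
  have hθ0 : 0 < θ := by positivity
  set A₀ := A.filter (fun a => ((nbrsIn G a T).card : ℝ) ≤ θ) with hA₀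
  set A₁ := A.filter (fun a => ¬ ((nbrsIn G a T).card : ℝ) ≤ θ) with hA₁
  have hsum : (A₀.card : ℝ) + A₁.card = A.card := by
    exact_mod_cast card_filter_add_card_filter_not (s := A)
      (fun a => ((nbrsIn G a T).card : ℝ) ≤ θ)
  rcases le_or_gt ((A.card : ℝ) / 2) A₀.card with hbig | hsmall
  · right
    refine ⟨A₀, (filter_subset _ _).trans hAS, T, hTS, ?_, by linarith, hTc,
      fun a ha => (mem_filter.1 ha).2⟩
    rw [disjoint_left]
    intro a ha haT
    exact (mem_filter.1 haT).2.2.1 (hvA a (mem_filter.1 ha).1)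
  left
  have hWA : (A.card : ℝ) / 2 ≤ A₁.card := by linarith
  refine hasPureBlockade_of_dense_pair hfree hx hxy hy hN hN0 (A := A₁) (T := T)
    (fun a ha => hvA a (filter_subset _ _ ha)) (fun r hr => (mem_filter.1 hr).2.2.1) hTN
    (by linarith) (fun r hr => ?_) (fun a ha => (not_le.1 (mem_filter.1 ha).2).le)
  have h1 : ((nbrsIn G r A₁).card : ℝ) ≤ (nbrsIn G r A).card := by
    exact_mod_cast nbrsIn_mono G r (filter_subset _ _)
  have h2 := (mem_filter.1 hr).2.2.2
  have h3 : 4 * y ^ 2 * A.card ≤ 8 * y ^ 2 * A₁.card := by nlinarith [sq_nonneg y]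
  linarith

/-- Iterating the extraction of sparse pairs gives a long sparse blockade. -/
lemma exists_sparse_blockade {V : Type*} [Fintype V] {G : SimpleGraph V}
    (hfree : Free P5ᶜ G) {x y : ℝ} (hx : 0 < x) (hxy : x ≤ y) (hy : y ≤ 1 / 2 ^ 40)
    (hpure : ¬ HasPureBlockade G x) {S : Finset V}
    (hN : y * Fintype.card V ≤ S.card) (hN' : 1 ≤ y ^ 6 * S.card)
    (hdeg : ∀ s ∈ S, ((nbrsIn G s S).card : ℝ) ≤ y ^ 3 * S.card)
    (hlarge : ∀ T ⊆ S, (S.card : ℝ) / 2 ≤ T.card →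
      ∃ v ∈ T, (y / 2) ^ 3 * T.card ≤ (nbrsIn G v T).card) (j : ℕ) :
    j * y ≤ 1 → ∃ T ⊆ S, (S.card : ℝ) - j * (y * S.card / 2) ≤ T.card ∧
      ∃ B : Fin j → Finset V, IsBlockade B ∧ (∀ i, Disjoint (B i) T) ∧
        (∀ i, y ^ 3 * S.card / 32 ≤ ((B i).card : ℝ)) ∧
        (∀ i, ∀ a ∈ B i, ((nbrsIn G a T).card : ℝ) ≤ x * (y ^ 3 * S.card / 32)) ∧
        SparseBlockade G x B := by
  have hy0 : 0 < y := hx.trans_le hxy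
  induction j with
  | zero =>
    intro _
    exact ⟨S, Subset.refl _, by simp, fun i => i.elim0, fun i => i.elim0, fun i => i.elim0,
      fun i => i.elim0, fun i => i.elim0, fun i => i.elim0⟩
  | succ j ih =>
    intro hj
    push_cast at hj
    obtain ⟨T, hTS, hTc, B, hB, hBT, hBc, hBs, hsp⟩ := ih (by linarith)
    have hhalf : (S.card : ℝ) / 2 ≤ T.card := by
      have : (j * y) * S.card ≤ 1 * S.card := by
        gcongr
        linarith
      linarith
    have hTle : (T.card : ℝ) ≤ S.card := by exact_mod_cast card_le_card hTS
    obtain ⟨v, hvT, hv⟩ := hlarge T hTS hhalf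
    obtain ⟨A, hAT, T', hT'T, hdis, hAc, hT'c, hAs⟩ :=
      (hasPureBlockade_or_exists_sparse_pair hfree hx hxy hy hN hN' hhalf hTle
        (fun s hs => le_trans (by exact_mod_cast nbrsIn_mono G s hTS) (hdeg s (hTS hs)))
        hvT hv).resolve_left hpure
    refine ⟨T', hT'T.trans hTS, by push_cast; linarith, Fin.cons A B, ?_, ?_, ?_, ?_, ?_⟩
    · intro i k
      refine Fin.cases ?_ (fun i => ?_) i <;> refine Fin.cases ?_ (fun k => ?_) k
      · intro h; exact absurd rfl h
      · intro _; simpa using ((hBT k).mono_right hAT).symm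
      · intro _; simpa using (hBT i).mono_right hAT
      · intro h; simpa using hB i k (by simpa using h)
    · intro i
      refine Fin.cases ?_ (fun i => ?_) i
      · simpa using hdis
      · simpa using (hBT i).mono_right hT'T
    · intro i
      refine Fin.cases ?_ (fun i => ?_) i
      · simpa using hAc
      · simpa using hBc i
    · intro i
      refine Fin.cases ?_ (fun i => ?_) i
      · simpa using hAs
      · intro a ha
        exact le_trans (by exact_mod_cast nbrsIn_mono G a hT'T) (hBs i a (by simpa using ha))
    · intro i k
      refine Fin.cases ?_ (fun i => ?_) i <;> refine Fin.cases ?_ (fun k => ?_) k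
      · intro h; exact absurd h (lt_irrefl _)
      · intro _ a ha
        have h1 : ((nbrsIn G a A).card : ℝ) ≤ (nbrsIn G a T).card := by
          exact_mod_cast nbrsIn_mono G a hAT
        have h2 := hBs k a (by simpa using ha)
        have h3 : x * (y ^ 3 * S.card / 32) ≤ x * A.card := by gcongr
        simpa using h1.trans (h2.trans h3)
      · intro h; exact absurd h (by simp)
      · intro h; simpa using hsp i k (by simpa using h)

lemma exists_equal_blockade {V : Type*} (s L : ℕ) :
    ∀ S : Finset V, L * s ≤ S.card →
      ∃ B : Fin L → Finset V, IsBlockade B ∧ ∀ i, B i ⊆ S ∧ (B i).card = s := by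
  induction L with
  | zero => exact fun S _ => ⟨fun i => i.elim0, fun i => i.elim0, fun i => i.elim0⟩
  | succ L ih =>
    intro S hS
    rw [add_mul, one_mul] at hS
    obtain ⟨Y, hYS, hY⟩ := exists_subset_card_eq (show s ≤ S.card by omega)
    obtain ⟨B, hB, hBS⟩ := ih (S \ Y) (by
      have := card_sdiff_add_card_eq_card hYS
      omega)
    have hdis : ∀ i, Disjoint Y (B i) := fun i => disjoint_sdiff.mono_right (hBS i).1
    refine ⟨Fin.cons Y B, ?_, ?_⟩
    · intro i j
      refine Fin.cases ?_ (fun i => ?_) i <;> refine Fin.cases ?_ (fun j => ?_) j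
      · intro h; exact absurd rfl h
      · intro _; simpa using hdis j
      · intro _; simpa using (hdis i).symm
      · intro h; simpa using hB i j (by simpa using h)
    · intro i
      refine Fin.cases ?_ (fun i => ?_) i
      · simpa using ⟨hYS, hY⟩
      · simpa using ⟨(hBS i).1.trans sdiff_subset, (hBS i).2⟩

/-- A sufficiently sparse set can be divided arbitrarily into a sparse blockade. -/
lemma exists_sparse_blockade_of_sparseOn {V : Type*} [Fintype V] {G : SimpleGraph V} {x y : ℝ}
    (hy0 : 0 < y) (hy : y ≤ 1 / 2 ^ 40) (hyx : y / 2 < x) {L : ℕ} (hL : L * y = 1)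
    {S : Finset V} (hN : y * Fintype.card V ≤ S.card) (hN' : 1 ≤ y ^ 6 * S.card)
    (hdeg : ∀ s ∈ S, ((nbrsIn G s S).card : ℝ) ≤ y ^ 3 * S.card) :
    ∃ B : Fin L → Finset V, IsBlockade B ∧
      (∀ i, y ^ 7 * (Fintype.card V : ℝ) ≤ ((B i).card : ℝ)) ∧ SparseBlockade G x B := by
  have hS0 : (0 : ℝ) ≤ y * S.card := by positivity
  have hpow : ∀ k : ℕ, k ≠ 0 → y ^ k ≤ 1 / 4 := fun k hk =>
    (pow_le_of_le_one hy0.le (hy.trans (by norm_num)) hk).trans (hy.trans (by norm_num))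
  have hfl : (⌊y * S.card⌋₊ : ℝ) ≤ y * S.card := Nat.floor_le hS0
  have hlow : y * S.card / 2 ≤ (⌊y * S.card⌋₊ : ℝ) := by
    have h1 := Nat.lt_floor_add_one (y * (S.card : ℝ))
    have h2 : y ^ 5 * (y * S.card) ≤ 1 / 4 * (y * S.card) := by
      gcongr
      exact hpow 5 (by norm_num)
    linarith
  obtain ⟨B, hB, hBS⟩ := exists_equal_blockade ⌊y * S.card⌋₊ L S (by
    have : (L : ℝ) * ⌊y * S.card⌋₊ ≤ S.card := by
      calc (L : ℝ) * ⌊y * S.card⌋₊ ≤ L * (y * S.card) := by gcongr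
        _ = S.card := by rw [← mul_assoc, hL, one_mul]
    exact_mod_cast this)
  refine ⟨B, hB, fun i => ?_, fun i j _ a ha => ?_⟩
  · rw [(hBS i).2]
    refine le_trans ?_ hlow
    have h1 : y ^ 6 * (y * Fintype.card V) ≤ y ^ 6 * S.card := by gcongr
    have h2 : y ^ 5 * (y * S.card) ≤ 1 / 4 * (y * S.card) := by
      gcongr
      exact hpow 5 (by norm_num)
    linarith
  · rw [(hBS i).2]
    have h1 : ((nbrsIn G a (B i)).card : ℝ) ≤ (nbrsIn G a S).card := by
      exact_mod_cast nbrsIn_mono G a (hBS i).1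
    have h2 := hdeg a ((hBS j).1 ha)
    have h3 : y / 2 * (y * S.card / 2) ≤ x * ⌊y * S.card⌋₊ :=
      mul_le_mul hyx.le hlow (by positivity) ((by positivity : 0 ≤ y / 2).trans hyx.le)
    have h4 : y ^ 1 * (y * (y * S.card)) ≤ 1 / 4 * (y * (y * S.card)) := by
      gcongr
      exact hpow 1 (by norm_num)
    linarith

/-- the iterative sparsification step for house-free graphs. -/
theorem house_free_step_three
    (V : Type) [Fintype V] (G : SimpleGraph V) (x : ℝ)
    (hx : 0 < x) (hx2 : x < (1 / 2 ^ 8 : ℝ) ^ 5)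
    (hsp : Sparse G ((1 / 2 ^ 8 : ℝ) ^ 16)) (hfree : Free P5ᶜ G)
    (hcard : x ^ (-(7 : ℝ)) ≤ (Fintype.card V : ℝ)) :
    (∃ k : ℝ, (2 : ℝ) ^ 8 ≤ k ∧ k ≤ 1 / x ∧
      ∃ (n : ℕ) (B : Fin n → Finset V), IsBlockade B ∧ k ≤ (n : ℝ) ∧
        (∀ i, (Fintype.card V : ℝ) / k ^ (34 : ℝ) ≤ ((B i).card : ℝ)) ∧
        PureBlockade G B) ∨
    (∃ y : ℝ, x ≤ y ∧ y ≤ (1 / 2 ^ 8 : ℝ) ^ 5 ∧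
      ∃ (n : ℕ) (B : Fin n → Finset V), IsBlockade B ∧ y⁻¹ ≤ (n : ℝ) ∧
        (∀ i, y ^ 7 * (Fintype.card V : ℝ) ≤ ((B i).card : ℝ)) ∧
        SparseBlockade G x B) := by
  set n : ℝ := (Fintype.card V : ℝ) with hn
  have hxn : 1 ≤ x ^ 7 * n := by
    have h : x ^ (-(7 : ℝ)) = (x ^ 7)⁻¹ := by
      rw [Real.rpow_neg hx.le]
      exact_mod_cast congrArg Inv.inv (Real.rpow_natCast x 7)
    rw [h, inv_le_iff_one_le_mul₀ (by positivity)] at hcard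
    linarith
  let P : ℕ → Prop := fun m => x ≤ (1 / 2) ^ m ∧ ∃ S : Finset V,
    (1 / 2 : ℝ) ^ m * n ≤ S.card ∧
    ∀ s ∈ S, ((nbrsIn G s S).card : ℝ) ≤ ((1 / 2 : ℝ) ^ m) ^ 3 * S.card
  have hP40 : P 40 := by
    refine ⟨hx2.le.trans (by norm_num), univ, ?_, fun s _ => (hsp s).trans ?_⟩
    · rw [card_univ]
      exact mul_le_of_le_one_left (by positivity) (by norm_num)
    · rw [card_univ]
      gcongr
      norm_num
  obtain ⟨m, hm40, ⟨hxm, S, hSn, hdeg⟩, hPm⟩ : ∃ m, 40 ≤ m ∧ P m ∧ ¬ P (m + 1) := by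
    by_contra! h
    obtain ⟨M, hM⟩ := exists_pow_lt_of_lt_one hx (show (1 / 2 : ℝ) < 1 by norm_num)
    have hall := Nat.le_induction (P := fun m _ => P m) hP40 h (M + 40) (by omega)
    have h1 : (1 / 2 : ℝ) ^ (M + 40) ≤ (1 / 2) ^ M :=
      pow_le_pow_of_le_one (by norm_num) (by norm_num) (by omega)
    linarith [hall.1]
  set y : ℝ := (1 / 2) ^ m with hydef
  have hy : y ≤ 1 / 2 ^ 40 := by
    rw [← one_div_pow]
    exact pow_le_pow_of_le_one (by norm_num) (by norm_num) hm40
  have hy0 : 0 < y := by positivity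
  have hL : ((2 ^ m : ℕ) : ℝ) * y = 1 := by
    push_cast
    rw [hydef, ← mul_pow]
    norm_num
  have hLinv : y⁻¹ ≤ ((2 ^ m : ℕ) : ℝ) := (inv_le_iff_one_le_mul₀ hy0).2 hL.ge
  have hN' : 1 ≤ y ^ 6 * S.card := by
    calc 1 ≤ x ^ 7 * n := hxn
      _ ≤ y ^ 7 * n := by gcongr
      _ = y ^ 6 * (y * n) := by ring
      _ ≤ y ^ 6 * S.card := by gcongr
  by_cases hpure : HasPureBlockade G x
  · exact Or.inl hpure
  refine Or.inr ⟨y, hxm, hy.trans (by norm_num), 2 ^ m, ?_⟩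
  have hyhalf : (1 / 2 : ℝ) ^ (m + 1) = y / 2 := by rw [pow_succ]; ring
  rcases lt_or_ge (y / 2) x with hyx | hyx
  · obtain ⟨B, hB, hBc, hBs⟩ := exists_sparse_blockade_of_sparseOn hy0 hy hyx hL hSn hN' hdeg
    exact ⟨B, hB, hLinv, hBc, hBs⟩
  · obtain ⟨-, -, -, B, hB, -, hBc, -, hBs⟩ :=
      exists_sparse_blockade hfree hx hxm hy hpure hSn hN' hdeg (by
        intro T hTS hT
        by_contra! h
        refine hPm ⟨hyhalf ▸ hyx, T, ?_, fun s hs => ?_⟩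
        · rw [hyhalf]
          linarith
        · rw [hyhalf]
          exact (h s hs).le) (2 ^ m) hL.le
    refine ⟨B, hB, hLinv, fun i => le_trans ?_ (hBc i), hBs⟩
    calc y ^ 7 * n = y ^ 3 * (y ^ 3 * (y * n)) := by ring
      _ ≤ (1 / 2 ^ 40) ^ 3 * (y ^ 3 * S.card) := by gcongr
      _ ≤ 1 / 32 * (y ^ 3 * S.card) := by
        gcongr
        norm_num
      _ = y ^ 3 * S.card / 32 := by ring
end
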